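/- arXiv:1706.03132 — 2 statements merged into one kernel-verified Lean document; each statement's English description precedes it below -/
import Mathlib

section
/- Let Γ be a primitive distance-regular graph with diameter D ≥ 3. Then Γ is Q-polynomial if and only if det(G) = 0, where G is the 4D×4D Gram matrix of the matrices A_2E_i*A − AE_i*A_2, A_3E_i* − E_i*A_3, A_2E_i* − E_i*A_2, AE_i* − E_i*A (1 ≤ i ≤ D). -/
open Matrix BigOperators

noncomputable section

structure DRG (X : Type) [Fintype X] [DecidableEq X] where
  G : SimpleGraph X
  D : ℕ
  hD : 3 ≤ D
  hconn : G.Connected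
  hdiam_le : ∀ y z : X, G.dist y z ≤ D
  hdiam : ∃ y z : X, G.dist y z = D
  p : ℕ → ℕ → ℕ → ℕ
  hp : ∀ h i j : ℕ, h ≤ D → i ≤ D → j ≤ D → ∀ y z : X, G.dist y z = h →
    Nat.card {w : X // G.dist y w = i ∧ G.dist z w = j} = p h i j

namespace DRG

variable {X : Type} [Fintype X] [DecidableEq X]

/-- The `i`-th distance matrix. -/
def A (Γ : DRG X) (i : ℕ) : Matrix X X ℂ :=
  Matrix.of fun y z => if Γ.G.dist y z = i then (1 : ℂ) else 0

/-- `c_i`, with the conventions `c_0 = 0` and `c_{D+1} = 1`. -/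
def cI (Γ : DRG X) (i : ℕ) : ℕ :=
  if i = 0 then 0 else if i ≤ Γ.D then Γ.p i 1 (i - 1) else 1

/-- `a_i`. -/
def aI (Γ : DRG X) (i : ℕ) : ℕ := Γ.p i 1 i

/-- `b_i`, with the convention `b_D = 0`. -/
def bI (Γ : DRG X) (i : ℕ) : ℕ := if i < Γ.D then Γ.p i 1 (i + 1) else 0

/-- `k_i`. -/
def kI (Γ : DRG X) (i : ℕ) : ℕ := Γ.p 0 i i

/-- The valency `k = b_0`. -/
def kval (Γ : DRG X) : ℕ := Γ.p 0 1 1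

/-- `Γ` is primitive: each distance-`i` graph is connected. -/
def Primitive (Γ : DRG X) : Prop :=
  ∀ i : ℕ, 1 ≤ i → i ≤ Γ.D →
    (SimpleGraph.fromRel fun y z => Γ.G.dist y z = i).Connected

/-- The Hermitean inner product `⟨R,S⟩ = tr(Rᵗ S̄)`. -/
def inn (R S : Matrix X X ℂ) : ℂ := (Rᵀ * S.map (starRingEnd ℂ)).trace

/-- The dual idempotent `E_i*` with respect to the base vertex `x`. -/
def Estar (Γ : DRG X) (x : X) (i : ℕ) : Matrix X X ℂ :=
  Matrix.diagonal fun y => if Γ.G.dist x y = i then (1 : ℂ) else 0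

/-- The polynomials `v_i`. -/
def vpoly (Γ : DRG X) : ℕ → Polynomial ℝ
  | 0 => 1
  | 1 => Polynomial.X
  | n + 2 =>
      ((Γ.cI (n + 2) : ℝ))⁻¹ •
        (Polynomial.X * vpoly Γ (n + 1) - (Γ.aI (n + 1) : ℝ) • vpoly Γ (n + 1)
          - (Γ.bI n : ℝ) • vpoly Γ n)

/-- The polynomials `u_i = v_i / k_i`. -/
def upoly (Γ : DRG X) (i : ℕ) : Polynomial ℝ := ((Γ.kI i : ℝ))⁻¹ • Γ.vpoly i

end DRG

/-- A system of primitive idempotents (with eigenvalues and Krein parameters) for `Γ`. -/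
structure IdemSys {X : Type} [Fintype X] [DecidableEq X] (Γ : DRG X) where
  E : Fin (Γ.D + 1) → Matrix X X ℂ
  θ : Fin (Γ.D + 1) → ℝ
  q : Fin (Γ.D + 1) → Fin (Γ.D + 1) → Fin (Γ.D + 1) → ℝ
  hE0 : E 0 = ((Fintype.card X : ℂ))⁻¹ • Matrix.of fun _ _ => (1 : ℂ)
  hEsum : ∑ i, E i = 1
  hEmul : ∀ i j, E i * E j = if i = j then E i else 0
  hEsymm : ∀ i, (E i)ᵀ = E i
  hEreal : ∀ i, (E i).map (starRingEnd ℂ) = E i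
  hEbasis : ∀ i, E i ∈ Submodule.span ℂ (Set.range fun n : Fin (Γ.D + 1) => Γ.A (n : ℕ))
  hEig : ∀ j, Γ.A 1 * E j = (θ j : ℂ) • E j
  hθ0 : θ 0 = (Γ.kval : ℝ)
  hθinj : Function.Injective θ
  hKrein : ∀ i j, Matrix.hadamard (E i) (E j) =
    ((Fintype.card X : ℂ))⁻¹ • ∑ h, (q h i j : ℂ) • E h

namespace IdemSys

variable {X : Type} [Fintype X] [DecidableEq X] {Γ : DRG X}

/-- `m_j`, the rank of `E_j`. -/
def m (I : IdemSys Γ) (j : Fin (Γ.D + 1)) : ℕ := (I.E j).rank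

/-- The dual distance matrix `A_i*` with respect to `x` and `E_i`. -/
def Astar (I : IdemSys Γ) (x : X) (i : Fin (Γ.D + 1)) : Matrix X X ℂ :=
  Matrix.diagonal fun y => (Fintype.card X : ℂ) * I.E i x y

end IdemSys

/-- `Γ` is Q-polynomial with respect to the ordering `E_{σ 0}, ..., E_{σ D}`. -/
def QPolyOrdering {X : Type} [Fintype X] [DecidableEq X] {Γ : DRG X} (I : IdemSys Γ)
    (σ : Equiv.Perm (Fin (Γ.D + 1))) : Prop :=
  ∀ h i j : Fin (Γ.D + 1),
    (((i : ℕ) + (j : ℕ) < (h : ℕ) ∨ (h : ℕ) + (j : ℕ) < (i : ℕ) ∨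
        (h : ℕ) + (i : ℕ) < (j : ℕ)) → I.q (σ h) (σ i) (σ j) = 0) ∧
    (((h : ℕ) = (i : ℕ) + (j : ℕ) ∨ (i : ℕ) = (h : ℕ) + (j : ℕ) ∨
        (j : ℕ) = (h : ℕ) + (i : ℕ)) → I.q (σ h) (σ i) (σ j) ≠ 0)

/-- The matrix `S^alt`. -/
def salt {n : ℕ} (S : Matrix (Fin (n + 1)) (Fin (n + 1)) ℂ) : Matrix (Fin n) (Fin n) ℂ :=
  Matrix.of fun i j => S i.succ j.succ - S 0 j.succ

/-- The matrix `(S^{-1})^alt`. -/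
def altInv {n : ℕ} (T : Matrix (Fin (n + 1)) (Fin (n + 1)) ℂ) : Matrix (Fin n) (Fin n) ℂ :=
  Matrix.of fun i j => T i.succ j.succ

/-- The `4D` matrices `A_2E_i*A − AE_i*A_2, A_3E_i* − E_i*A_3, A_2E_i* − E_i*A_2, AE_i* − E_i*A`. -/
def vecE {X : Type} [Fintype X] [DecidableEq X] (Γ : DRG X) (x : X)
    (a : Fin 4) (i : Fin Γ.D) : Matrix X X ℂ :=
  ![Γ.A 2 * Γ.Estar x ((i : ℕ) + 1) * Γ.A 1 - Γ.A 1 * Γ.Estar x ((i : ℕ) + 1) * Γ.A 2,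
    Γ.A 3 * Γ.Estar x ((i : ℕ) + 1) - Γ.Estar x ((i : ℕ) + 1) * Γ.A 3,
    Γ.A 2 * Γ.Estar x ((i : ℕ) + 1) - Γ.Estar x ((i : ℕ) + 1) * Γ.A 2,
    Γ.A 1 * Γ.Estar x ((i : ℕ) + 1) - Γ.Estar x ((i : ℕ) + 1) * Γ.A 1] a

/-- The `4D` matrices `A_2A_i*A − AA_i*A_2, A_3A_i* − A_i*A_3, A_2A_i* − A_i*A_2, AA_i* − A_i*A`. -/
def vecA {X : Type} [Fintype X] [DecidableEq X] {Γ : DRG X} (I : IdemSys Γ) (x : X)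
    (a : Fin 4) (i : Fin Γ.D) : Matrix X X ℂ :=
  ![Γ.A 2 * I.Astar x i.succ * Γ.A 1 - Γ.A 1 * I.Astar x i.succ * Γ.A 2,
    Γ.A 3 * I.Astar x i.succ - I.Astar x i.succ * Γ.A 3,
    Γ.A 2 * I.Astar x i.succ - I.Astar x i.succ * Γ.A 2,
    Γ.A 1 * I.Astar x i.succ - I.Astar x i.succ * Γ.A 1] a

namespace SimpleGraph

theorem Connected.exists_adj_dist_eq {V : Type*} {G : SimpleGraph V} (hG : G.Connected)
    {u v : V} {n : ℕ} (h : G.dist u v = n + 1) : ∃ w, G.Adj w v ∧ G.dist u w = n := by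
  obtain ⟨p, hp⟩ := hG.exists_walk_length_eq_dist v u
  rw [dist_comm, h] at hp
  cases p with
  | nil => simp at hp
  | cons hadj q =>
    rename_i w
    refine ⟨w, hadj.symm, ?_⟩
    have h1 : G.dist w u ≤ q.length := dist_le q
    have h2 : G.dist v u ≤ G.dist v w + G.dist w u := hG.dist_triangle
    rw [dist_eq_one_iff_adj.2 hadj, dist_comm, h] at h2
    simp only [Walk.length_cons] at hp
    rw [dist_comm]
    omega

theorem Connected.exists_dist_eq_of_le {V : Type*} {G : SimpleGraph V} (hG : G.Connected)
    {u v : V} {n : ℕ} (h : n ≤ G.dist u v) : ∃ w, G.dist u w = n := by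
  induction h using Nat.decreasingInduction with
  | self => exact ⟨v, rfl⟩
  | of_succ k hk ih =>
    obtain ⟨w, hw⟩ := ih
    obtain ⟨w', -, hw'⟩ := hG.exists_adj_dist_eq hw
    exact ⟨w', hw'⟩

end SimpleGraph

namespace DRG

variable {X : Type} [Fintype X] [DecidableEq X] (Γ : DRG X)

theorem exists_dist_eq (x : X) {n : ℕ} (hn : n ≤ Γ.D) : ∃ y, Γ.G.dist x y = n := by
  obtain ⟨y, z, hyz⟩ := Γ.hdiam
  obtain ⟨w, hw⟩ := Γ.hconn.exists_dist_eq_of_le (u := y) (v := z) (n := n) (by omega)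
  have hy := Γ.hp 0 n n (Nat.zero_le _) hn hn y y Γ.G.dist_self
  have hx := Γ.hp 0 n n (Nat.zero_le _) hn hn x x Γ.G.dist_self
  have : Nonempty {w : X // Γ.G.dist y w = n ∧ Γ.G.dist y w = n} := ⟨⟨w, hw, hw⟩⟩
  have hpos := Nat.card_pos (α := {w : X // Γ.G.dist y w = n ∧ Γ.G.dist y w = n})
  rw [hy, ← hx] at hpos
  obtain ⟨⟨v, hv, -⟩⟩ := (Nat.card_pos_iff.1 hpos).1
  exact ⟨v, hv⟩

theorem A_apply (n : ℕ) (y z : X) : Γ.A n y z = if Γ.G.dist y z = n then 1 else 0 := rfl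

theorem A_zero : Γ.A 0 = 1 := by
  ext y z
  simp [A_apply, Matrix.one_apply, Γ.hconn.dist_eq_zero_iff]

theorem A_transpose (n : ℕ) : (Γ.A n)ᵀ = Γ.A n := by
  ext y z
  simp [A_apply, SimpleGraph.dist_comm]

theorem A_one_mul_apply {m n : ℕ} (hm : m ≤ Γ.D) (hn : n ≤ Γ.D) {y z : X}
    (h : Γ.G.dist y z = m) : (Γ.A 1 * Γ.A n) y z = Γ.p m 1 n := by
  classical
  rw [← Γ.hp m 1 n hm (by have := Γ.hD; omega) hn y z h, Nat.card_eq_fintype_card,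
    Fintype.card_subtype, Finset.card_filter]
  simp only [Matrix.mul_apply, A_apply, Γ.G.dist_comm (u := z)]
  push_cast
  refine Finset.sum_congr rfl fun w _ => ?_
  by_cases h1 : Γ.G.dist y w = 1 <;> simp [h1]

theorem A_one_mul {n : ℕ} (hn : n ≤ Γ.D) :
    Γ.A 1 * Γ.A n = ∑ m ∈ Finset.range (Γ.D + 1), (Γ.p m 1 n : ℂ) • Γ.A m := by
  ext y z
  have hd := Γ.hdiam_le y z
  rw [Γ.A_one_mul_apply hd hn rfl, Matrix.sum_apply, Finset.sum_eq_single (Γ.G.dist y z)]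
  · simp [A_apply]
  · intro m _ hm
    simp [A_apply, Ne.symm hm]
  · intro h
    exact absurd (Finset.mem_range.2 (by omega)) h

theorem p_one_eq_zero {m n : ℕ} (hm : m ≤ Γ.D) (hn : n ≤ Γ.D) (h : n + 1 < m) :
    Γ.p m 1 n = 0 := by
  obtain ⟨y, -, -⟩ := Γ.hdiam
  obtain ⟨z, hz⟩ := Γ.exists_dist_eq y hm
  rw [← Γ.hp m 1 n hm (by have := Γ.hD; omega) hn y z hz, Nat.card_eq_zero]
  refine Or.inl ⟨fun ⟨w, h1, h2⟩ => ?_⟩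
  have := Γ.hconn.dist_triangle (u := y) (v := w) (w := z)
  rw [SimpleGraph.dist_comm] at h2
  omega

theorem p_succ_one_ne_zero {n : ℕ} (hn : n + 1 ≤ Γ.D) : Γ.p (n + 1) 1 n ≠ 0 := by
  obtain ⟨y, -, -⟩ := Γ.hdiam
  obtain ⟨z, hz⟩ := Γ.exists_dist_eq y hn
  rw [SimpleGraph.dist_comm] at hz
  obtain ⟨w, h1, h2⟩ := Γ.hconn.exists_adj_dist_eq hz
  rw [SimpleGraph.dist_comm] at hz
  rw [← Γ.hp (n + 1) 1 n hn (by have := Γ.hD; omega) (by omega) y z hz]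
  have : Nonempty {w : X // Γ.G.dist y w = 1 ∧ Γ.G.dist z w = n} :=
    ⟨⟨w, SimpleGraph.dist_eq_one_iff_adj.2 h1.symm, h2⟩⟩
  exact Nat.card_pos.ne'

/-- The three-term recurrence, without identifying the lower coefficients. -/
theorem A_one_mul_eq {n : ℕ} (hn : n + 1 ≤ Γ.D) :
    Γ.A 1 * Γ.A n = ∑ m ∈ Finset.range (n + 1), (Γ.p m 1 n : ℂ) • Γ.A m +
      (Γ.p (n + 1) 1 n : ℂ) • Γ.A (n + 1) := by
  rw [Γ.A_one_mul (by omega), ← Finset.sum_range_succ]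
  refine (Finset.sum_subset (Finset.range_subset_range.2 (by omega)) fun m hm hm' => ?_).symm
  simp only [Finset.mem_range] at hm hm'
  rw [Γ.p_one_eq_zero (by omega) (by omega) (by omega)]
  simp

theorem linearIndependent_A : LinearIndependent ℂ fun n : Fin (Γ.D + 1) => Γ.A n := by
  rw [Fintype.linearIndependent_iff]
  intro g hg n
  obtain ⟨y, -, -⟩ := Γ.hdiam
  obtain ⟨z, hz⟩ := Γ.exists_dist_eq y (Nat.lt_succ_iff.1 n.2)
  have := congrFun (congrFun hg y) z
  simpa [Matrix.sum_apply, A_apply, hz, Fin.val_inj] using this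

end DRG

namespace IdemSys

variable {X : Type} [Fintype X] [DecidableEq X] {Γ : DRG X} (I : IdemSys Γ)

theorem exists_A_mul_E (n : ℕ) (hn : n ≤ Γ.D) (j : Fin (Γ.D + 1)) :
    ∃ v : ℂ, Γ.A n * I.E j = v • I.E j := by
  induction n using Nat.strong_induction_on with
  | _ n ih =>
    cases n with
    | zero => exact ⟨1, by rw [Γ.A_zero, one_mul, one_smul]⟩
    | succ n =>
      have hc : (Γ.p (n + 1) 1 n : ℂ) ≠ 0 := Nat.cast_ne_zero.2 (Γ.p_succ_one_ne_zero hn)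
      choose! f hf using fun m (hm : m < n + 1) => ih m hm (by omega)
      have hrec := congrArg (· * I.E j) (Γ.A_one_mul_eq hn)
      simp only [add_mul, Finset.sum_mul, smul_mul_assoc, mul_assoc, hf n (by omega),
        mul_smul_comm, I.hEig] at hrec
      rw [Finset.sum_congr rfl fun m hm => by
        rw [hf m (Finset.mem_range.1 hm), smul_smul], ← Finset.sum_smul] at hrec
      refine ⟨(Γ.p (n + 1) 1 n : ℂ)⁻¹ * (f n * I.θ j -
        ∑ m ∈ Finset.range (n + 1), (Γ.p m 1 n : ℂ) * f m), ?_⟩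
      rw [mul_smul, sub_smul, mul_smul, hrec, add_sub_cancel_left, smul_smul,
        inv_mul_cancel₀ hc, one_smul]

/-- The eigenvalue of `A_n` on the `j`-th eigenspace. -/
def eigval (n : ℕ) (j : Fin (Γ.D + 1)) : ℂ :=
  if hn : n ≤ Γ.D then (I.exists_A_mul_E n hn j).choose else 0

variable {I} in
theorem A_mul_E {n : ℕ} (hn : n ≤ Γ.D) (j : Fin (Γ.D + 1)) :
    Γ.A n * I.E j = I.eigval n j • I.E j := by
  rw [eigval, dif_pos hn]
  exact (I.exists_A_mul_E n hn j).choose_spec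

variable {I} in
theorem E_mul_A {n : ℕ} (hn : n ≤ Γ.D) (j : Fin (Γ.D + 1)) :
    I.E j * Γ.A n = I.eigval n j • I.E j := by
  have := congrArg Matrix.transpose (A_mul_E (I := I) hn j)
  rwa [Matrix.transpose_mul, Matrix.transpose_smul, I.hEsymm, Γ.A_transpose] at this

theorem A_eq_sum {n : ℕ} (hn : n ≤ Γ.D) : Γ.A n = ∑ j, I.eigval n j • I.E j := by
  simp_rw [← A_mul_E hn, ← Finset.mul_sum, I.hEsum, mul_one]

theorem A_mul_A_comm (I : IdemSys Γ) {m n : ℕ} (hm : m ≤ Γ.D) (hn : n ≤ Γ.D) :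
    Γ.A m * Γ.A n = Γ.A n * Γ.A m := by
  rw [I.A_eq_sum hm]
  simp only [Finset.sum_mul, Finset.mul_sum, smul_mul_assoc, mul_smul_comm, A_mul_E hn, E_mul_A hn]

theorem linearIndependent_E : LinearIndependent ℂ I.E := by
  rw [linearIndependent_iff_card_le_finrank_span, Set.finrank]
  have h : Submodule.span ℂ (Set.range fun n : Fin (Γ.D + 1) => Γ.A n) ≤
      Submodule.span ℂ (Set.range I.E) := by
    rw [Submodule.span_le]
    rintro _ ⟨n, rfl⟩
    simp only [SetLike.mem_coe]
    rw [I.A_eq_sum (Nat.lt_succ_iff.1 n.2)]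
    exact Submodule.sum_mem _ fun j _ =>
      Submodule.smul_mem _ _ (Submodule.subset_span (Set.mem_range_self j))
  have := Submodule.finrank_mono h
  rwa [finrank_span_eq_card Γ.linearIndependent_A] at this

theorem E_ne_zero (j : Fin (Γ.D + 1)) : I.E j ≠ 0 := I.linearIndependent_E.ne_zero j

theorem E_coeff_eq {f g : Fin (Γ.D + 1) → ℂ} (h : ∑ j, f j • I.E j = ∑ j, g j • I.E j)
    (j : Fin (Γ.D + 1)) : f j = g j :=
  Fintype.linearIndependent_iff.1 I.linearIndependent_E (fun j => f j - g j)
    (by simp only [sub_smul, Finset.sum_sub_distrib, h, sub_self]) j |> sub_eq_zero.1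

theorem eigval_zero (j : Fin (Γ.D + 1)) : I.eigval 0 j = 1 := by
  have h := A_mul_E (I := I) (Nat.zero_le _) j
  rw [Γ.A_zero, one_mul] at h
  exact (smul_left_injective ℂ (I.E_ne_zero j) (by simpa using h)).symm

theorem eigval_one (j : Fin (Γ.D + 1)) : I.eigval 1 j = I.θ j := by
  have h := A_mul_E (I := I) (by have := Γ.hD; omega : 1 ≤ Γ.D) j
  rw [I.hEig] at h
  exact (smul_left_injective ℂ (I.E_ne_zero j) h).symm

theorem θ_mul_eigval {n : ℕ} (hn : n + 1 ≤ Γ.D) (j : Fin (Γ.D + 1)) :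
    I.θ j * I.eigval n j = ∑ m ∈ Finset.range (n + 1), (Γ.p m 1 n : ℂ) * I.eigval m j +
      (Γ.p (n + 1) 1 n : ℂ) * I.eigval (n + 1) j := by
  have h := congrArg (· * I.E j) (Γ.A_one_mul_eq hn)
  simp only [add_mul, Finset.sum_mul, smul_mul_assoc, mul_assoc, A_mul_E (I := I) hn,
    A_mul_E (I := I) (by omega : n ≤ Γ.D), mul_smul_comm, I.hEig] at h
  rw [Finset.sum_congr rfl fun m hm => by
    rw [A_mul_E (I := I) (by have := Finset.mem_range.1 hm; omega : m ≤ Γ.D), smul_smul],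
    ← Finset.sum_smul, smul_smul, smul_smul, ← add_smul] at h
  rw [mul_comm]
  exact smul_left_injective ℂ (I.E_ne_zero j) h

theorem E_apply_eq (j : Fin (Γ.D + 1)) {y z y' z' : X} (h : Γ.G.dist y z = Γ.G.dist y' z') :
    I.E j y z = I.E j y' z' := by
  refine Submodule.span_induction (p := fun M _ => M y z = M y' z') ?_ rfl ?_ ?_ (I.hEbasis j)
  · rintro _ ⟨n, rfl⟩
    simp [DRG.A_apply, h]
  · intro M N _ _ hM hN
    simp [hM, hN]
  · intro a M _ hM
    simp [hM]

theorem E_symm (j : Fin (Γ.D + 1)) (y z : X) : I.E j z y = I.E j y z :=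
  congrFun (congrFun (I.hEsymm j) y) z

theorem E_conj (j : Fin (Γ.D + 1)) (y z : X) : starRingEnd ℂ (I.E j y z) = I.E j y z :=
  congrFun (congrFun (I.hEreal j) y) z

theorem sum_E_mul_E (j : Fin (Γ.D + 1)) (y z : X) : ∑ w, I.E j y w * I.E j w z = I.E j y z := by
  rw [← Matrix.mul_apply, I.hEmul, if_pos rfl]

theorem E_diag_ne_zero (j : Fin (Γ.D + 1)) (y : X) : I.E j y y ≠ 0 := by
  intro h
  refine I.E_ne_zero j ?_
  ext z w
  have hz : I.E j z z = 0 := by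
    rw [← h]
    exact I.E_apply_eq j (by simp)
  have hs := I.sum_E_mul_E j z z
  have hs' : ∑ w, ((Complex.normSq (I.E j z w) : ℝ) : ℂ) = 0 := by
    rw [← hz, ← hs]
    refine Finset.sum_congr rfl fun w _ => ?_
    rw [← Complex.mul_conj, E_conj, I.E_symm j z w]
  rw [← Complex.ofReal_sum, Complex.ofReal_eq_zero,
    Finset.sum_eq_zero_iff_of_nonneg fun _ _ => Complex.normSq_nonneg _] at hs'
  exact Complex.normSq_eq_zero.1 (hs' w (Finset.mem_univ _))

theorem trace_E_ne_zero (j : Fin (Γ.D + 1)) : (I.E j).trace ≠ 0 := by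
  obtain ⟨y, -, -⟩ := Γ.hdiam
  have : (I.E j).trace = Fintype.card X * I.E j y y := by
    rw [Matrix.trace, ← nsmul_eq_mul, ← Finset.card_univ, ← Finset.sum_const]
    exact Finset.sum_congr rfl fun z _ => I.E_apply_eq j (by simp)
  rw [this]
  have : Nonempty X := ⟨y⟩
  exact mul_ne_zero (Nat.cast_ne_zero.2 Fintype.card_ne_zero) (I.E_diag_ne_zero j y)

theorem card_ne_zero (_ : IdemSys Γ) : (Fintype.card X : ℂ) ≠ 0 := by
  obtain ⟨y, -, -⟩ := Γ.hdiam
  have : Nonempty X := ⟨y⟩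
  exact Nat.cast_ne_zero.2 Fintype.card_ne_zero

theorem E_col_eq (j : Fin (Γ.D + 1)) {y z : X} (h : I.E j y z = I.E j y y) (w : X) :
    I.E j w y = I.E j w z := by
  have hz : I.E j z z = I.E j y y := I.E_apply_eq j (by simp)
  have hs : ∑ w, ((Complex.normSq (I.E j w y - I.E j w z) : ℝ) : ℂ) = 0 := by
    have : ∀ w, ((Complex.normSq (I.E j w y - I.E j w z) : ℝ) : ℂ) =
        I.E j y w * I.E j w y - I.E j y w * I.E j w z - I.E j z w * I.E j w y +
          I.E j z w * I.E j w z := by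
      intro w
      rw [← Complex.mul_conj, map_sub, E_conj, E_conj, I.E_symm j w y, I.E_symm j w z]
      ring
    simp only [this, Finset.sum_add_distrib, Finset.sum_sub_distrib, sum_E_mul_E]
    rw [I.E_symm j y z, h, hz]
    ring
  rw [← Complex.ofReal_sum, Complex.ofReal_eq_zero,
    Finset.sum_eq_zero_iff_of_nonneg fun _ _ => Complex.normSq_nonneg _] at hs
  exact sub_eq_zero.1 (Complex.normSq_eq_zero.1 (hs w (Finset.mem_univ _)))

theorem sum_E_row {j : Fin (Γ.D + 1)} (hj : j ≠ 0) (y : X) : ∑ w, I.E j y w = 0 := by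
  have h := congrFun (congrFun (I.hEmul j 0) y) y
  rw [if_neg hj, I.hE0, mul_smul_comm, Matrix.smul_apply, Matrix.mul_apply] at h
  simpa [I.card_ne_zero] using h

theorem E_apply_ne (hprim : Γ.Primitive) {j : Fin (Γ.D + 1)} (hj : j ≠ 0) {y z : X}
    (hyz : y ≠ z) : I.E j y z ≠ I.E j y y := by
  intro h
  have hpos : 1 ≤ Γ.G.dist y z := Γ.hconn.pos_dist_of_ne hyz
  have hc := hprim _ hpos (Γ.hdiam_le y z)
  have hcol : ∀ u v w, I.E j w u = I.E j w v := by
    intro u v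
    obtain ⟨p⟩ := hc.preconnected u v
    induction p with
    | nil => exact fun _ => rfl
    | cons hadj _ ih =>
      rename_i a b c _
      intro w
      rw [← ih w]
      refine I.E_col_eq j ?_ w
      have hd : Γ.G.dist a b = Γ.G.dist y z := by
        rw [SimpleGraph.fromRel_adj] at hadj
        rcases hadj.2 with h | h
        · exact h
        · rw [SimpleGraph.dist_comm, h]
      rw [I.E_apply_eq j hd, h]
      exact I.E_apply_eq j (by simp)
  have hrow := I.sum_E_row hj y
  rw [Finset.sum_congr rfl fun w _ => hcol w y y, Finset.sum_const, Finset.card_univ,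
    nsmul_eq_mul] at hrow
  exact (mul_ne_zero I.card_ne_zero (I.E_diag_ne_zero j y)) hrow

theorem krein_trace (h i j : Fin (Γ.D + 1)) :
    ∑ y, ∑ z, I.E i y z * I.E j y z * I.E h y z =
      (Fintype.card X : ℂ)⁻¹ * (I.q h i j * (I.E h).trace) := by
  have key := congrArg (fun M => (M * I.E h).trace) (I.hKrein i j)
  simp only [smul_mul_assoc, Finset.sum_mul, I.hEmul, Matrix.trace_smul, smul_ite, smul_zero,
    Finset.sum_ite_eq', Finset.mem_univ, if_true, smul_eq_mul] at key
  rw [← key, Matrix.trace]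
  refine Finset.sum_congr rfl fun y _ => ?_
  rw [Matrix.diag_apply, Matrix.mul_apply]
  refine Finset.sum_congr rfl fun z _ => ?_
  rw [Matrix.hadamard_apply, I.E_symm h y z]

theorem q_comm (h i j : Fin (Γ.D + 1)) : I.q h i j = I.q h j i := by
  have h1 := I.krein_trace h i j
  have h2 := I.krein_trace h j i
  simp only [mul_comm (I.E j _ _) (I.E i _ _)] at h2
  rw [h1] at h2
  have := mul_right_cancel₀ (I.trace_E_ne_zero h)
    (mul_left_cancel₀ (inv_ne_zero I.card_ne_zero) h2)
  exact_mod_cast this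

theorem q_rotate_eq_zero_iff (h i j : Fin (Γ.D + 1)) : I.q h i j = 0 ↔ I.q i h j = 0 := by
  have h1 := I.krein_trace h i j
  have h2 := I.krein_trace i h j
  have h3 : ∀ y z, I.E h y z * I.E j y z * I.E i y z = I.E i y z * I.E j y z * I.E h y z :=
    fun y z => by ring
  simp only [h3] at h2
  rw [h1] at h2
  have h4 := mul_left_cancel₀ (inv_ne_zero I.card_ne_zero) h2
  constructor
  · intro h0
    simpa [h0, I.trace_E_ne_zero] using h4.symm
  · intro h0
    simpa [h0, I.trace_E_ne_zero] using h4

theorem q_zero (h j : Fin (Γ.D + 1)) : I.q h 0 j = if h = j then 1 else 0 := by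
  have hk := I.hKrein 0 j
  have : Matrix.hadamard (I.E 0) (I.E j) = (Fintype.card X : ℂ)⁻¹ • I.E j := by
    rw [I.hE0]
    ext y z
    simp
  rw [this] at hk
  have hk' := smul_right_injective (Matrix X X ℂ) (inv_ne_zero I.card_ne_zero) hk
  have := I.E_coeff_eq (f := fun h => if h = j then 1 else 0) (g := fun h => (I.q h 0 j : ℂ))
    (by simpa using hk') h
  split_ifs at this ⊢ with hh <;> exact_mod_cast this.symm

theorem q_assoc (h a b c : Fin (Γ.D + 1)) :
    ∑ l, I.q l a b * I.q h l c = ∑ l, I.q l b c * I.q h a l := by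
  have h1 : Matrix.hadamard (∑ l, (I.q l a b : ℂ) • I.E l) (I.E c) =
      Matrix.hadamard (I.E a) (∑ l, (I.q l b c : ℂ) • I.E l) := by
    have e1 := congrArg ((Fintype.card X : ℂ) • ·) (I.hKrein a b)
    have e2 := congrArg ((Fintype.card X : ℂ) • ·) (I.hKrein b c)
    simp only [smul_smul, mul_inv_cancel₀ I.card_ne_zero, one_smul] at e1 e2
    rw [← e1, ← e2, Matrix.smul_hadamard, Matrix.hadamard_smul, Matrix.hadamard_assoc]
  have h2 : ∀ (s : Fin (Γ.D + 1) → ℂ) (d : Fin (Γ.D + 1)),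
      Matrix.hadamard (∑ l, s l • I.E l) (I.E d) =
        (Fintype.card X : ℂ)⁻¹ • ∑ h, (∑ l, s l * I.q h l d) • I.E h := by
    intro s d
    have : Matrix.hadamard (∑ l, s l • I.E l) (I.E d) =
        ∑ l, s l • Matrix.hadamard (I.E l) (I.E d) := by
      ext y z
      simp [Matrix.sum_apply, Finset.sum_mul, mul_assoc]
    rw [this]
    simp only [I.hKrein, Finset.sum_smul, Finset.smul_sum, smul_smul]
    rw [Finset.sum_comm]
    refine Finset.sum_congr rfl fun h _ => Finset.sum_congr rfl fun l _ => ?_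
    ring_nf
  rw [Matrix.hadamard_comm (I.E a), h2, h2] at h1
  have h3 := I.E_coeff_eq (smul_right_injective (Matrix X X ℂ) (inv_ne_zero I.card_ne_zero) h1) h
  simp only [I.q_comm h _ a] at h3
  exact_mod_cast h3

end IdemSys

namespace DRG

section InnerProduct

variable {X : Type} [Fintype X]

theorem inn_eq_sum (R S : Matrix X X ℂ) :
    inn R S = ∑ y, ∑ z, R y z * starRingEnd ℂ (S y z) := by
  rw [Finset.sum_comm]
  simp [inn, Matrix.trace, Matrix.mul_apply]

theorem inn_self_eq_zero {R : Matrix X X ℂ} (h : inn R R = 0) : R = 0 := by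
  rw [inn_eq_sum] at h
  simp only [Complex.mul_conj] at h
  norm_cast at h
  ext y z
  have h1 := (Finset.sum_eq_zero_iff_of_nonneg fun y _ => Finset.sum_nonneg fun z _ =>
    Complex.normSq_nonneg (R y z)).1 h y (Finset.mem_univ _)
  exact Complex.normSq_eq_zero.1 ((Finset.sum_eq_zero_iff_of_nonneg fun z _ =>
    Complex.normSq_nonneg (R y z)).1 h1 z (Finset.mem_univ _))

theorem inn_sum_smul_right {ι : Type*} [Fintype ι] (R : Matrix X X ℂ) (w : ι → ℂ)
    (u : ι → Matrix X X ℂ) :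
    inn R (∑ i, w i • u i) = ∑ i, inn R (u i) * starRingEnd ℂ (w i) := by
  simp only [inn_eq_sum, Matrix.sum_apply, Matrix.smul_apply, smul_eq_mul, map_sum, map_mul,
    Finset.mul_sum, Finset.sum_mul]
  rw [Finset.sum_comm_cycle]
  refine Finset.sum_congr rfl fun i _ => Finset.sum_congr rfl fun y _ =>
    Finset.sum_congr rfl fun z _ => ?_
  ring

theorem inn_sum_smul_left {ι : Type*} [Fintype ι] (R : Matrix X X ℂ) (w : ι → ℂ)
    (u : ι → Matrix X X ℂ) :
    inn (∑ i, w i • u i) R = ∑ i, w i * inn (u i) R := by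
  simp only [inn_eq_sum, Matrix.sum_apply, Matrix.smul_apply, smul_eq_mul,
    Finset.mul_sum, Finset.sum_mul]
  rw [Finset.sum_comm_cycle]
  refine Finset.sum_congr rfl fun i _ => Finset.sum_congr rfl fun y _ =>
    Finset.sum_congr rfl fun z _ => ?_
  ring

end InnerProduct

variable {X : Type} [Fintype X] [DecidableEq X] (Γ : DRG X)

/-- The four brackets `A_2WA − AWA_2`, `A_3W − WA_3`, `A_2W − WA_2`, `AW − WA`, linear in `W`. -/
def bracket (a : Fin 4) : Matrix X X ℂ →ₗ[ℂ] Matrix X X ℂ :=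
  ![LinearMap.mulLeft ℂ (Γ.A 2) ∘ₗ LinearMap.mulRight ℂ (Γ.A 1) -
      LinearMap.mulLeft ℂ (Γ.A 1) ∘ₗ LinearMap.mulRight ℂ (Γ.A 2),
    LinearMap.mulLeft ℂ (Γ.A 3) - LinearMap.mulRight ℂ (Γ.A 3),
    LinearMap.mulLeft ℂ (Γ.A 2) - LinearMap.mulRight ℂ (Γ.A 2),
    LinearMap.mulLeft ℂ (Γ.A 1) - LinearMap.mulRight ℂ (Γ.A 1)] a

theorem vecE_eq_bracket (x : X) (a : Fin 4) (i : Fin Γ.D) :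
    vecE Γ x a i = Γ.bracket a (Γ.Estar x ((i : ℕ) + 1)) := by
  fin_cases a <;> simp [vecE, bracket, mul_assoc]

theorem diagonal_eq_Estar (x : X) (g : ℕ → ℂ) :
    Matrix.diagonal (fun y => g (Γ.G.dist x y)) =
      g 0 • (1 : Matrix X X ℂ) +
        ∑ n : Fin Γ.D, (g ((n : ℕ) + 1) - g 0) • Γ.Estar x ((n : ℕ) + 1) := by
  have h : ∀ y, g (Γ.G.dist x y) = g 0 + ∑ n : Fin Γ.D, (g ((n : ℕ) + 1) - g 0) *
      (if Γ.G.dist x y = (n : ℕ) + 1 then (1 : ℂ) else 0) := by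
    intro y
    have hd := Γ.hdiam_le x y
    rcases hm : Γ.G.dist x y with _ | m
    · simp
    · rw [Finset.sum_eq_single (⟨m, by omega⟩ : Fin Γ.D)]
      · simp
      · intro n _ hn
        rw [if_neg, mul_zero]
        intro hmn
        exact hn (Fin.ext (by simp only; omega))
      · simp
  ext y z
  by_cases hyz : y = z
  · subst hyz
    simp [Matrix.sum_apply, Estar, h y]
  · simp [Matrix.sum_apply, Estar, hyz]

theorem det_gram_eq_zero_iff {ι : Type*} [Fintype ι] [DecidableEq ι] (u : ι → Matrix X X ℂ) :
    (Matrix.of fun p r => inn (u p) (u r)).det = 0 ↔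
      ∃ w : ι → ℂ, w ≠ 0 ∧ ∑ p, w p • u p = 0 := by
  rw [← Matrix.exists_mulVec_eq_zero_iff]
  constructor
  · rintro ⟨v, hv, h⟩
    refine ⟨fun p => starRingEnd ℂ (v p), fun h0 => hv ?_, inn_self_eq_zero ?_⟩
    · ext p
      simpa using congrFun h0 p
    · rw [inn_sum_smul_left]
      refine Finset.sum_eq_zero fun p _ => ?_
      have hp := congrFun h p
      rw [inn_sum_smul_right]
      simp only [Matrix.mulVec, dotProduct, Matrix.of_apply, Pi.zero_apply] at hp
      simp [hp]
  · rintro ⟨w, hw, h⟩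
    refine ⟨fun p => starRingEnd ℂ (w p), fun h0 => hw ?_, ?_⟩
    · ext p
      simpa using congrFun h0 p
    · ext p
      have := inn_sum_smul_right (u p) w u
      rw [h] at this
      simp only [Matrix.mulVec, dotProduct, Matrix.of_apply, Pi.zero_apply]
      rw [← this]
      simp [inn]

end DRG

namespace IdemSys

variable {X : Type} [Fintype X] [DecidableEq X] {Γ : DRG X} (I : IdemSys Γ)

theorem trace_triple (x : X) (h k i i' : Fin (Γ.D + 1)) :
    (I.E h * I.Astar x i * I.E k * I.Astar x i').trace =
      if i = i' then (Fintype.card X : ℂ) * (I.q i h k * I.E i x x) else 0 := by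
  have h1 : (I.E h * I.Astar x i * I.E k * I.Astar x i').trace =
      (Fintype.card X : ℂ) ^ 2 * (I.E i * Matrix.hadamard (I.E h) (I.E k) * I.E i') x x := by
    rw [Matrix.trace, Matrix.mul_apply, Finset.mul_sum]
    refine Finset.sum_congr rfl fun u _ => ?_
    simp only [Astar, Matrix.diag_apply, Matrix.mul_diagonal]
    rw [Matrix.mul_apply, Matrix.mul_apply, Finset.sum_mul, Finset.sum_mul, Finset.mul_sum]
    refine Finset.sum_congr rfl fun v _ => ?_
    rw [Matrix.mul_diagonal, Matrix.hadamard_apply, I.E_symm h v u, I.E_symm i' x u]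
    ring
  rw [h1, I.hKrein]
  simp only [mul_smul_comm, smul_mul_assoc, Finset.mul_sum, I.hEmul, smul_ite, smul_zero, Finset.sum_ite_eq, Finset.mem_univ, if_true]
  have := I.card_ne_zero
  split_ifs with hi
  · simp only [Matrix.smul_apply, smul_eq_mul]
    field_simp
  · simp

open scoped ComplexOrder in
theorem E_mul_Astar_mul_E_eq_zero (x : X) {h k i : Fin (Γ.D + 1)} (hq : I.q i h k = 0) :
    I.E h * I.Astar x i * I.E k = 0 := by
  rw [← Matrix.trace_mul_conjTranspose_self_eq_zero_iff]
  have hE : ∀ j, (I.E j)ᴴ = I.E j := fun j => by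
    ext y z
    rw [Matrix.conjTranspose_apply, I.E_symm j y z]
    exact I.E_conj j y z
  have hA : (I.Astar x i)ᴴ = I.Astar x i := by
    rw [Astar, Matrix.diagonal_conjTranspose]
    congr 1
    ext y
    have := I.E_conj i x y
    simpa using Or.inl this
  rw [Matrix.conjTranspose_mul, Matrix.conjTranspose_mul, hE, hE, hA]
  have : I.E h * I.Astar x i * I.E k * (I.E k * (I.Astar x i * I.E h)) =
      I.E h * I.Astar x i * I.E k * I.Astar x i * I.E h := by
    have hk := I.hEmul k k
    rw [if_pos rfl] at hk
    simp only [mul_assoc]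
    rw [← mul_assoc (I.E k) (I.E k), hk]
  rw [this, Matrix.trace_mul_comm]
  have hh := I.hEmul h h
  rw [if_pos rfl] at hh
  simp only [← mul_assoc]
  rw [hh, I.trace_triple, if_pos rfl, hq]
  simp

theorem coeff_mul_q_eq_zero (x : X) {h k : Fin (Γ.D + 1)} {c : Fin (Γ.D + 1) → ℂ}
    (hc : I.E h * (∑ i, c i • I.Astar x i) * I.E k = 0) (i : Fin (Γ.D + 1)) :
    c i * I.q i h k = 0 := by
  have := congrArg (fun M => (M * I.Astar x i).trace) hc
  simp only [Finset.mul_sum, Finset.sum_mul, mul_smul_comm, smul_mul_assoc, Matrix.trace_sum,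
    Matrix.trace_smul, I.trace_triple, smul_eq_mul, mul_ite, mul_zero, Finset.sum_ite_eq',
    Finset.mem_univ, if_true, zero_mul, Matrix.trace_zero, mul_eq_zero, I.card_ne_zero, false_or,
    I.E_diag_ne_zero, or_false] at this
  exact mul_eq_zero.2 this

/-- The scalar by which a bracket acts on the block `E_h W E_k`. -/
def bracketScalar (a : Fin 4) (h k : Fin (Γ.D + 1)) : ℂ :=
  ![I.eigval 2 h * I.eigval 1 k - I.eigval 1 h * I.eigval 2 k,
    I.eigval 3 h - I.eigval 3 k, I.eigval 2 h - I.eigval 2 k, I.eigval 1 h - I.eigval 1 k] a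

theorem E_mul_bracket_mul_E (a : Fin 4) (h k : Fin (Γ.D + 1)) (W : Matrix X X ℂ) :
    I.E h * Γ.bracket a W * I.E k = I.bracketScalar a h k • (I.E h * W * I.E k) := by
  have hD := Γ.hD
  have hl : ∀ n ≤ Γ.D, ∀ M, I.E h * (Γ.A n * M) = I.eigval n h • (I.E h * M) := fun n hn M => by
    rw [← mul_assoc, E_mul_A hn, smul_mul_assoc]
  fin_cases a <;>
    simp [DRG.bracket, bracketScalar, mul_sub, sub_mul, mul_assoc, sub_smul, mul_smul,
      hl 1 (by omega), hl 2 (by omega), hl 3 hD, A_mul_E (I := I) hD,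
      A_mul_E (I := I) (by omega : 1 ≤ Γ.D), A_mul_E (I := I) (by omega : 2 ≤ Γ.D)]

theorem eq_zero_of_blocks {M : Matrix X X ℂ} (hM : ∀ h k, I.E h * M * I.E k = 0) : M = 0 := by
  have : (∑ h, I.E h) * M * (∑ k, I.E k) = 0 := by
    simp only [Finset.sum_mul, Finset.mul_sum, hM, Finset.sum_const_zero]
  rwa [I.hEsum, one_mul, mul_one] at this

theorem sum_bracket_Astar_eq_zero (x : X) {i : Fin (Γ.D + 1)} {t : Fin 4 → ℂ}
    (ht : ∀ h k, I.q i h k ≠ 0 → ∑ a, t a * I.bracketScalar a h k = 0) :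
    ∑ a, t a • Γ.bracket a (I.Astar x i) = 0 := by
  refine I.eq_zero_of_blocks fun h k => ?_
  simp only [Finset.mul_sum, Finset.sum_mul, mul_smul_comm, smul_mul_assoc, E_mul_bracket_mul_E,
    smul_smul, ← Finset.sum_smul]
  by_cases hq : I.q i h k = 0
  · rw [I.E_mul_Astar_mul_E_eq_zero x hq, smul_zero]
  · rw [ht h k hq, zero_smul]

theorem bracket_one (I : IdemSys Γ) (a : Fin 4) : Γ.bracket a 1 = 0 := by
  refine I.eq_zero_of_blocks fun h k => ?_
  rw [E_mul_bracket_mul_E, mul_one, I.hEmul]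
  split_ifs with hhk
  · subst hhk
    fin_cases a <;> simp [bracketScalar, mul_comm]
  · simp

/-- The entry of `E_j` at distance `n`. -/
def cosine (j : Fin (Γ.D + 1)) (x : X) (n : ℕ) : ℂ :=
  if hn : n ≤ Γ.D then I.E j x (Γ.exists_dist_eq x hn).choose else 0

theorem E_eq_cosine (j : Fin (Γ.D + 1)) (x y : X) : I.E j x y = I.cosine j x (Γ.G.dist x y) := by
  have hn := Γ.hdiam_le x y
  rw [cosine, dif_pos hn]
  exact I.E_apply_eq j (Γ.exists_dist_eq x hn).choose_spec.symm

theorem Astar_eq_Estar (x : X) (i : Fin (Γ.D + 1)) :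
    I.Astar x i = ((Fintype.card X : ℂ) * I.cosine i x 0) • (1 : Matrix X X ℂ) +
      ∑ n : Fin Γ.D, ((Fintype.card X : ℂ) * I.cosine i x ((n : ℕ) + 1) -
        (Fintype.card X : ℂ) * I.cosine i x 0) • Γ.Estar x ((n : ℕ) + 1) := by
  rw [← Γ.diagonal_eq_Estar x fun n => (Fintype.card X : ℂ) * I.cosine i x n, Astar]
  simp only [I.E_eq_cosine]

theorem Estar_eq_Astar (x : X) {n : ℕ} (hn : n ≤ Γ.D) :
    Γ.Estar x n = ∑ j, ((Fintype.card X : ℂ)⁻¹ * I.eigval n j) • I.Astar x j := by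
  have hA := I.A_eq_sum hn
  ext y z
  by_cases hyz : y = z
  · subst hyz
    have := congrFun (congrFun hA x) y
    rw [DRG.A_apply] at this
    simp only [DRG.Estar, Astar, Matrix.sum_apply, Matrix.smul_apply, Matrix.diagonal_apply_eq,
      smul_eq_mul] at this ⊢
    rw [this]
    refine Finset.sum_congr rfl fun j _ => ?_
    have := I.card_ne_zero
    field_simp
  · simp [DRG.Estar, Astar, Matrix.sum_apply, hyz]

theorem dependency_iff (hprim : Γ.Primitive) (x : X) :
    (∃ w : Fin Γ.D × Fin 4 → ℂ, w ≠ 0 ∧ ∑ p, w p • vecE Γ x p.2 p.1 = 0) ↔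
      ∃ i : Fin (Γ.D + 1), i ≠ 0 ∧ ∃ t : Fin 4 → ℂ, t ≠ 0 ∧
        ∀ h k, I.q i h k ≠ 0 → ∑ a, t a * I.bracketScalar a h k = 0 := by
  have hD := Γ.hD
  simp only [DRG.vecE_eq_bracket, Fintype.sum_prod_type_right]
  constructor
  · rintro ⟨w, hw, hdep⟩
    set c : Fin (Γ.D + 1) → Fin 4 → ℂ := fun j a =>
      ∑ n : Fin Γ.D, w (n, a) * ((Fintype.card X : ℂ)⁻¹ * I.eigval ((n : ℕ) + 1) j) with hcdef
    have hW : ∀ a, ∑ n : Fin Γ.D, w (n, a) • Γ.Estar x ((n : ℕ) + 1) =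
        ∑ j, c j a • I.Astar x j := by
      intro a
      rw [Finset.sum_congr rfl fun n _ => by rw [I.Estar_eq_Astar x (by omega)]]
      simp only [hcdef, Finset.smul_sum, Finset.sum_smul, smul_smul]
      rw [Finset.sum_comm]
    have hc : ∃ j, j ≠ 0 ∧ c j ≠ 0 := by
      by_contra! hcon
      apply hw
      have h1 : ∀ a, ∑ n : Fin Γ.D, w (n, a) • Γ.Estar x ((n : ℕ) + 1) = c 0 a • 1 := by
        intro a
        rw [hW, Finset.sum_eq_single 0]
        · congr 1
          ext y z
          simp [Astar, I.hE0, I.card_ne_zero, Matrix.one_apply, Matrix.diagonal_apply]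
        · intro j _ hj
          rw [hcon j hj, Pi.zero_apply, zero_smul]
        · simp
      have h0 : ∀ a, c 0 a = 0 := by
        intro a
        have := congrFun (congrFun (h1 a) x) x
        simpa [Matrix.sum_apply, DRG.Estar] using this.symm
      ext ⟨n, a⟩
      obtain ⟨y, hy⟩ := Γ.exists_dist_eq x (by omega : (n : ℕ) + 1 ≤ Γ.D)
      have := congrFun (congrFun (h1 a) y) y
      simpa [Matrix.sum_apply, DRG.Estar, hy, h0, Fin.val_inj] using this
    obtain ⟨j, hj, hcj⟩ := hc
    refine ⟨j, hj, c j, hcj, fun h k hq => ?_⟩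
    have hsum : ∑ a, Γ.bracket a (∑ j, c j a • I.Astar x j) = 0 := by
      rw [← hdep]
      refine Finset.sum_congr rfl fun a _ => ?_
      rw [← hW, map_sum]
      simp only [map_smul]
    have hblock := congrArg (fun M => I.E h * M * I.E k) hsum
    simp only [Finset.mul_sum, Finset.sum_mul, E_mul_bracket_mul_E, mul_zero, zero_mul] at hblock
    have hcomb : I.E h * (∑ j, (∑ a, c j a * I.bracketScalar a h k) • I.Astar x j) * I.E k = 0 := by
      rw [← hblock]
      simp only [Finset.mul_sum, Finset.sum_mul, mul_smul_comm, smul_mul_assoc, Finset.smul_sum,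
        smul_smul, Finset.sum_smul]
      rw [Finset.sum_comm]
      refine Finset.sum_congr rfl fun a _ => Finset.sum_congr rfl fun l _ => ?_
      rw [mul_comm]
    have := I.coeff_mul_q_eq_zero x hcomb j
    exact (mul_eq_zero.1 this).resolve_right (by exact_mod_cast hq)
  · rintro ⟨i, hi, t, ht, hrel⟩
    have hsum := I.sum_bracket_Astar_eq_zero x hrel
    refine ⟨fun p => t p.2 * ((Fintype.card X : ℂ) * I.cosine i x ((p.1 : ℕ) + 1) -
        (Fintype.card X : ℂ) * I.cosine i x 0), fun h0 => ht ?_, ?_⟩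
    · ext a
      have := congrFun h0 (⟨0, by omega⟩, a)
      obtain ⟨y, hy⟩ := Γ.exists_dist_eq x (by omega : 1 ≤ Γ.D)
      have hne := I.E_apply_ne hprim hi (y := x) (z := y) (fun h => by simp [← h] at hy)
      rw [I.E_eq_cosine, I.E_eq_cosine, hy, SimpleGraph.dist_self] at hne
      simpa [← mul_sub, I.card_ne_zero, sub_eq_zero, hne] using this
    · rw [← hsum, I.Astar_eq_Estar]
      refine Finset.sum_congr rfl fun a _ => ?_
      rw [map_add, map_smul, I.bracket_one, smul_zero, zero_add, map_sum, Finset.smul_sum]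
      simp only [map_smul, smul_smul]

end IdemSys

namespace SimpleGraph

theorem Connected.dist_injective_of_path_like {V : Type*} {G : SimpleGraph V} (hG : G.Connected)
    {v : V} (hv : ∀ u w, G.Adj v u → G.Adj v w → u = w)
    (hdeg : ∀ a u w s, G.Adj a u → G.Adj a w → G.Adj a s → u = w ∨ u = s ∨ w = s) :
    Function.Injective (G.dist v) := by
  have key : ∀ n u w, G.dist v u = n → G.dist v w = n → u = w := by
    intro n
    induction n with
    | zero =>
      intro u w hu hw
      rw [← hG.dist_eq_zero_iff.1 hu, ← hG.dist_eq_zero_iff.1 hw]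
    | succ n ih =>
      intro u w hu hw
      obtain ⟨u', hu', hdu⟩ := hG.exists_adj_dist_eq hu
      obtain ⟨w', hw', hdw⟩ := hG.exists_adj_dist_eq hw
      obtain rfl := ih u' w' hdu hdw
      cases n with
      | zero =>
        obtain rfl := hG.dist_eq_zero_iff.1 hdu
        exact hv _ _ hu' hw'
      | succ n =>
        obtain ⟨s, hs, hds⟩ := hG.exists_adj_dist_eq hdu
        rcases hdeg u' u w s hu' hw' hs.symm with h | h | h
        · exact h
        · subst h; omega
        · subst h; omega
  exact fun u w h => key _ u w h rfl

theorem Connected.exists_path_ordering {n : ℕ} {G : SimpleGraph (Fin (n + 1))}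
    (hG : G.Connected) (h0 : ∀ u w, G.Adj 0 u → G.Adj 0 w → u = w)
    (hdeg : ∀ a u w s, G.Adj a u → G.Adj a w → G.Adj a s → u = w ∨ u = s ∨ w = s) :
    ∃ σ : Equiv.Perm (Fin (n + 1)), σ 0 = 0 ∧
      ∀ a b, G.Adj (σ a) (σ b) ↔ (a : ℕ) + 1 = b ∨ (b : ℕ) + 1 = a := by
  have hinj := hG.dist_injective_of_path_like h0 hdeg
  have hlt : ∀ u, G.dist 0 u < n + 1 := by
    intro u
    obtain ⟨p, hp, hlen⟩ := hG.exists_path_of_dist 0 u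
    simpa [hlen] using hp.length_lt
  let f : Fin (n + 1) → Fin (n + 1) := fun u => ⟨G.dist 0 u, hlt u⟩
  have hf : Function.Bijective f := Finite.injective_iff_bijective.1 fun u w h =>
    hinj (Fin.mk.inj h)
  let σ := (Equiv.ofBijective f hf).symm
  have hσ : ∀ a, G.dist 0 (σ a) = a := fun a =>
    congrArg Fin.val ((Equiv.ofBijective f hf).apply_symm_apply a)
  have hsucc : ∀ a b : Fin (n + 1), (a : ℕ) + 1 = b → G.Adj (σ a) (σ b) := by
    intro a b hab
    obtain ⟨w, hw, hdw⟩ := hG.exists_adj_dist_eq ((hσ b).trans hab.symm)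
    rwa [← hinj ((hσ a).trans hdw.symm)] at hw
  refine ⟨σ, hinj ((hσ 0).trans (by simp)), fun a b => ⟨fun hab => ?_, ?_⟩⟩
  · have h1 := hG.dist_triangle (u := 0) (v := σ a) (w := σ b)
    have h2 := hG.dist_triangle (u := 0) (v := σ b) (w := σ a)
    rw [dist_eq_one_iff_adj.2 hab, hσ, hσ] at h1
    rw [dist_eq_one_iff_adj.2 hab.symm, hσ, hσ] at h2
    have : (a : ℕ) ≠ b := fun h => hab.ne (congrArg σ (Fin.ext h))
    omega
  · rintro (h | h)
    · exact hsucc a b h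
    · exact (hsucc b a h).symm

end SimpleGraph

theorem quadratic_coeffs_eq_zero {K : Type*} [Field K] {a b c x y z : K} (hxy : x ≠ y)
    (hxz : x ≠ z) (hyz : y ≠ z) (hx : a * x ^ 2 + b * x + c = 0) (hy : a * y ^ 2 + b * y + c = 0)
    (hz : a * z ^ 2 + b * z + c = 0) : a = 0 ∧ b = 0 ∧ c = 0 := by
  have h1 : a * (x + y) + b = 0 := by
    refine (mul_eq_zero.1 (?_ : (x - y) * (a * (x + y) + b) = 0)).resolve_left (sub_ne_zero.2 hxy)
    linear_combination hx - hy
  have h2 : a * (x + z) + b = 0 := by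
    refine (mul_eq_zero.1 (?_ : (x - z) * (a * (x + z) + b) = 0)).resolve_left (sub_ne_zero.2 hxz)
    linear_combination hx - hz
  have ha : a = 0 := by
    refine (mul_eq_zero.1 (?_ : (y - z) * a = 0)).resolve_left (sub_ne_zero.2 hyz)
    linear_combination h1 - h2
  subst ha
  have hb : b = 0 := by linear_combination h1
  subst hb
  exact ⟨rfl, rfl, by linear_combination hx⟩

namespace IdemSys

variable {X : Type} [Fintype X] [DecidableEq X] {Γ : DRG X} (I : IdemSys Γ)

theorem hadamard_mul_E (i j h : Fin (Γ.D + 1)) :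
    Matrix.hadamard (I.E i) (I.E j) * I.E h =
      ((Fintype.card X : ℂ)⁻¹ * I.q h i j) • I.E h := by
  rw [I.hKrein]
  simp only [smul_mul_assoc, Finset.sum_mul, I.hEmul, smul_ite, smul_zero, Finset.sum_ite_eq',
    Finset.mem_univ, if_true, smul_smul]

theorem eq_univ_of_closed (hprim : Γ.Primitive) {i : Fin (Γ.D + 1)} (hi : i ≠ 0)
    (S : Finset (Fin (Γ.D + 1))) (h0 : 0 ∈ S) (hS : ∀ h ∈ S, ∀ k ∉ S, I.q i h k = 0) :
    S = Finset.univ := by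
  obtain ⟨x, -, -⟩ := Γ.hdiam
  set F : Matrix X X ℂ := ∑ j ∈ S, I.E j with hF
  have hFG : F + ∑ j ∈ Sᶜ, I.E j = 1 := by rw [hF, Finset.sum_add_sum_compl, I.hEsum]
  have hFE : ∀ h, F * I.E h = if h ∈ S then I.E h else 0 := fun h => by
    simp [hF, Finset.sum_mul, I.hEmul]
  have hsum : ∀ T : Finset (Fin (Γ.D + 1)), ∀ h, Matrix.hadamard (I.E i) (∑ j ∈ T, I.E j) * I.E h =
      ∑ j ∈ T, ((Fintype.card X : ℂ)⁻¹ * I.q h i j) • I.E h := by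
    intro T h
    simp_rw [← I.hadamard_mul_E, ← Finset.sum_mul]
    congr 1
    ext y z
    simp [Matrix.sum_apply, Finset.mul_sum]
  have hone : Matrix.hadamard (I.E i) 1 = I.E i x x • (1 : Matrix X X ℂ) := by
    ext y z
    by_cases hyz : y = z
    · subst hyz
      simpa using I.E_apply_eq i (by simp)
    · simp [hyz]
  have hblock : ∀ h, Matrix.hadamard (I.E i) F * I.E h = (I.E i x x • F) * I.E h := by
    intro h
    rw [smul_mul_assoc, hFE]
    split_ifs with hh
    · have h1 : Matrix.hadamard (I.E i) (F + ∑ j ∈ Sᶜ, I.E j) * I.E h = I.E i x x • I.E h := by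
        rw [hFG, hone, smul_mul_assoc, one_mul]
      rw [Matrix.hadamard_add, add_mul, hsum Sᶜ, Finset.sum_eq_zero, add_zero] at h1
      · exact h1
      · intro j hj
        rw [(I.q_rotate_eq_zero_iff h i j).2 (hS h hh j (Finset.mem_compl.1 hj))]
        simp
    · rw [hF, hsum, smul_zero]
      refine Finset.sum_eq_zero fun j hj => ?_
      rw [(I.q_rotate_eq_zero_iff h i j).2 (by rw [I.q_comm]; exact hS j hj h hh)]
      simp
  have hmain : Matrix.hadamard (I.E i) F = I.E i x x • F := by
    have := Finset.sum_congr rfl fun h (_ : h ∈ Finset.univ) => hblock h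
    rwa [← Finset.mul_sum, ← Finset.mul_sum, I.hEsum, mul_one, mul_one] at this
  have hoff : ∀ y z, y ≠ z → F y z = 0 := by
    intro y z hyz
    have h1 := congrFun (congrFun hmain y) z
    rw [Matrix.hadamard_apply, Matrix.smul_apply, smul_eq_mul,
      I.E_apply_eq i (y' := y) (z' := y) (y := x) (z := x) (by simp)] at h1
    by_contra hne
    exact I.E_apply_ne hprim hi hyz (mul_right_cancel₀ hne h1)
  have hF1 : F = 1 := by
    ext y z
    by_cases hyz : y = z
    · subst hyz
      have h1 := congrFun (congrFun (hFE 0) y) y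
      rw [if_pos h0, Matrix.mul_apply,
        Finset.sum_eq_single y (fun w _ hw => by rw [hoff y w (Ne.symm hw), zero_mul]) (by simp)] at h1
      rw [Matrix.one_apply_eq]
      exact mul_right_cancel₀ (I.E_diag_ne_zero 0 y) (by rw [h1, one_mul])
    · rw [hoff y z hyz, Matrix.one_apply_ne hyz]
  ext j
  simp only [Finset.mem_univ, iff_true]
  by_contra hj
  have := hFE j
  rw [hF1, one_mul, if_neg hj] at this
  exact I.E_ne_zero j this

/-- The representation diagram of `E_i`. -/
def diagram (i : Fin (Γ.D + 1)) : SimpleGraph (Fin (Γ.D + 1)) where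
  Adj h k := h ≠ k ∧ I.q i h k ≠ 0
  symm := ⟨fun h k hk => ⟨hk.1.symm, by rw [I.q_comm]; exact hk.2⟩⟩
  loopless := ⟨fun _ h => h.1 rfl⟩

theorem diagram_connected (hprim : Γ.Primitive) {i : Fin (Γ.D + 1)} (hi : i ≠ 0) :
    (I.diagram i).Connected := by
  classical
  have hS := I.eq_univ_of_closed hprim hi
    (Finset.univ.filter fun h => (I.diagram i).Reachable 0 h) (by simp) (by
      intro h hh k hk
      simp only [Finset.mem_filter, Finset.mem_univ, true_and] at hh hk
      by_contra hq
      refine hk (hh.trans (SimpleGraph.Adj.reachable ⟨?_, hq⟩))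
      rintro rfl
      exact hk hh)
  rw [SimpleGraph.connected_iff_exists_forall_reachable]
  refine ⟨0, fun h => ?_⟩
  have := Finset.mem_univ h
  rw [← hS] at this
  simpa using this

theorem diagram_zero_adj {i k : Fin (Γ.D + 1)} (hi : i ≠ 0) :
    (I.diagram i).Adj 0 k ↔ k = i := by
  simp only [diagram, I.q_zero]
  constructor
  · rintro ⟨-, h⟩
    by_contra hne
    simp [Ne.symm hne] at h
  · rintro rfl
    simp [hi.symm]

/-- The relation defined by four bracket coefficients, as a symmetric quadratic relation between
eigenvalues. -/
theorem exists_quadratic {t : Fin 4 → ℂ} (ht : t ≠ 0) :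
    ∃ p q r w : ℂ, ¬(p = 0 ∧ q = 0 ∧ r = 0 ∧ w = 0) ∧ (p = 0 → t 1 = 0) ∧
      (p = 0 → q ≠ 0 → t 0 ≠ 0) ∧ ∀ h k, h ≠ k → ∑ a, t a * I.bracketScalar a h k = 0 →
        p * ((I.θ h : ℂ) ^ 2 + (I.θ k : ℂ) ^ 2) + q * I.θ h * I.θ k +
          r * ((I.θ h : ℂ) + I.θ k) + w = 0 := by
  have hD := Γ.hD
  have hc2 : (Γ.p 2 1 1 : ℂ) ≠ 0 := Nat.cast_ne_zero.2 (Γ.p_succ_one_ne_zero (by omega))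
  have hc3 : (Γ.p 3 1 2 : ℂ) ≠ 0 := Nat.cast_ne_zero.2 (Γ.p_succ_one_ne_zero (by omega))
  have h1 := fun j => I.θ_mul_eigval (by omega : 1 + 1 ≤ Γ.D) j
  have h2 := fun j => I.θ_mul_eigval (by omega : 2 + 1 ≤ Γ.D) j
  simp only [Finset.sum_range_succ, Finset.sum_range_zero, zero_add, I.eigval_zero, I.eigval_one,
    Nat.reduceAdd, mul_one] at h1 h2
  generalize (Γ.p 2 1 1 : ℂ) = c2 at *
  generalize (Γ.p 3 1 2 : ℂ) = c3 at *
  generalize (Γ.p 1 1 1 : ℂ) = a1 at *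
  generalize (Γ.p 0 1 1 : ℂ) = κ at *
  generalize (Γ.p 2 1 2 : ℂ) = a2 at *
  generalize (Γ.p 1 1 2 : ℂ) = b1 at *
  generalize (Γ.p 0 1 2 : ℂ) = e at *
  refine ⟨t 1, t 0 * c3 + t 1, t 2 * c3 - t 1 * (a1 + a2),
    t 0 * c3 * κ + t 1 * (a1 * a2 - κ - c2 * b1) - t 2 * c3 * a1 + t 3 * c2 * c3,
    ?_, id, ?_, ?_⟩
  · rintro ⟨e1, e2, e3, e4⟩
    have e0 : t 0 = 0 := by simpa [e1, hc3] using e2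
    have e2' : t 2 = 0 := by simpa [e1, hc3] using e3
    have e3' : t 3 = 0 := by simpa [e0, e1, e2', hc2, hc3] using e4
    refine ht ?_
    ext a
    fin_cases a <;> simp [e0, e1, e2', e3']
  · intro e1 e2 e0
    simp [e0, e1] at e2
  · intro h k hhk hrel
    have hθ : (I.θ h : ℂ) - I.θ k ≠ 0 := by
      rw [sub_ne_zero]
      exact_mod_cast I.hθinj.ne hhk
    have h1h := h1 h
    have h1k := h1 k
    have h2h := h2 h
    have h2k := h2 k
    simp only [Fin.sum_univ_four, bracketScalar, Matrix.cons_val, I.eigval_one] at hrel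
    generalize (I.θ h : ℂ) = s at *
    generalize (I.θ k : ℂ) = u at *
    generalize I.eigval 2 h = v2 at *
    generalize I.eigval 2 k = w2 at *
    generalize I.eigval 3 h = v3 at *
    generalize I.eigval 3 k = w3 at *
    refine (mul_eq_zero.1 (?_ : (s - u) * _ = 0)).resolve_left hθ
    linear_combination c2 * c3 * hrel + (t 0 * c3 * u + t 2 * c3 + t 1 * (s - a2)) * h1h
      - (t 0 * c3 * s + t 2 * c3 + t 1 * (u - a2)) * h1k + t 1 * c2 * h2h - t 1 * c2 * h2k

/-- An element of the bracket span with no `A_3` part forces equal cosines at distances `1, 2`. -/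
theorem cosine_one_eq_two {i : Fin (Γ.D + 1)} {t : Fin 4 → ℂ} (h0 : t 0 ≠ 0) (h1 : t 1 = 0)
    (hrel : ∀ h k, I.q i h k ≠ 0 → ∑ a, t a * I.bracketScalar a h k = 0) {x y z : X}
    (hy : Γ.G.dist x y = 1) (hz : Γ.G.dist x z = 2) : I.E i x y = I.E i x z := by
  have hD := Γ.hD
  obtain ⟨v, hv⟩ := Γ.exists_dist_eq x hD
  have hsum := congrFun (congrFun (I.sum_bracket_Astar_eq_zero x hrel) x) v
  have e2 : (Γ.A 2 * (I.Astar x i * Γ.A 1)) x v =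
      (Fintype.card X : ℂ) * I.E i x z * (Γ.A 2 * Γ.A 1) x v := by
    rw [Matrix.mul_apply, Matrix.mul_apply, Finset.mul_sum]
    refine Finset.sum_congr rfl fun w _ => ?_
    rw [Astar, Matrix.diagonal_mul, Γ.A_apply 2]
    split_ifs with hw
    · rw [I.E_apply_eq i (hw.trans hz.symm)]; ring
    · simp
  have e1 : (Γ.A 1 * (I.Astar x i * Γ.A 2)) x v =
      (Fintype.card X : ℂ) * I.E i x y * (Γ.A 2 * Γ.A 1) x v := by
    rw [← I.A_mul_A_comm (by omega : 1 ≤ Γ.D) (by omega : 2 ≤ Γ.D), Matrix.mul_apply,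
      Matrix.mul_apply, Finset.mul_sum]
    refine Finset.sum_congr rfl fun w _ => ?_
    rw [Astar, Matrix.diagonal_mul, Γ.A_apply 1]
    split_ifs with hw
    · rw [I.E_apply_eq i (hw.trans hy.symm)]; ring
    · simp
  have hne : (Γ.A 2 * Γ.A 1) x v ≠ 0 := by
    rw [← I.A_mul_A_comm (by omega : 1 ≤ Γ.D) (by omega : 2 ≤ Γ.D),
      Γ.A_one_mul_apply (m := 3) hD (by omega) hv]
    exact Nat.cast_ne_zero.2 (Γ.p_succ_one_ne_zero hD)
  have hb2 : (Γ.A 2 * I.Astar x i - I.Astar x i * Γ.A 2) x v = 0 := by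
    simp [Astar, DRG.A_apply, hv]
  have hb1 : (Γ.A 1 * I.Astar x i - I.Astar x i * Γ.A 1) x v = 0 := by
    simp [Astar, DRG.A_apply, hv]
  simp only [Fin.sum_univ_four, DRG.bracket, Matrix.cons_val, Matrix.add_apply, Matrix.smul_apply,
    LinearMap.sub_apply, LinearMap.comp_apply, LinearMap.mulLeft_apply, LinearMap.mulRight_apply,
    hb1, hb2, h1, zero_smul, add_zero, Matrix.sub_apply (Γ.A 2 * (I.Astar x i * Γ.A 1)),
    e1, e2, Matrix.zero_apply, smul_eq_mul] at hsum
  have : t 0 * ((Fintype.card X : ℂ) * (Γ.A 2 * Γ.A 1) x v * (I.E i x y - I.E i x z)) = 0 := by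
    linear_combination -hsum
  simpa [h0, I.card_ne_zero, hne, sub_eq_zero] using this

theorem exists_E_apply_ne {x y z : X} (hy : Γ.G.dist x y = 1) (hz : Γ.G.dist x z = 2) :
    ∃ j, I.E j x y ≠ I.E j x z := by
  by_contra! h
  have hA := I.A_eq_sum (by have := Γ.hD; omega : 1 ≤ Γ.D)
  have h1 := congrFun (congrFun hA x) y
  have h2 := congrFun (congrFun hA x) z
  simp only [Matrix.sum_apply, Matrix.smul_apply, h] at h1 h2
  rw [← h2] at h1
  simp [DRG.A_apply, hy, hz] at h1

theorem not_star (hprim : Γ.Primitive) {i : Fin (Γ.D + 1)} (hi : i ≠ 0) {t : Fin 4 → ℂ}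
    (h0 : t 0 ≠ 0) (h1 : t 1 = 0)
    (hrel : ∀ h k, I.q i h k ≠ 0 → ∑ a, t a * I.bracketScalar a h k = 0)
    (hstar : ∀ h k, (I.diagram i).Adj h k → h = i ∨ k = i) : False := by
  have hD := Γ.hD
  obtain ⟨x, -, -⟩ := Γ.hdiam
  obtain ⟨y, hy⟩ := Γ.exists_dist_eq x (by omega : 1 ≤ Γ.D)
  obtain ⟨z, hz⟩ := Γ.exists_dist_eq x (by omega : 2 ≤ Γ.D)
  have hcos := I.cosine_one_eq_two h0 h1 hrel hy hz
  obtain ⟨j, hj⟩ := I.exists_E_apply_ne hy hz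
  have hji : j ≠ i := by rintro rfl; exact hj hcos
  have hj0 : j ≠ 0 := by
    rintro rfl
    simp [I.hE0] at hj
  have hprod : ∀ w, (Fintype.card X : ℂ) * (I.E i x w * I.E j x w) =
      I.q j i j * I.E j x w + I.q i i j * I.E i x w := by
    intro w
    have hk := congrFun (congrFun (I.hKrein i j) x) w
    rw [Finset.sum_eq_add j i hji] at hk
    · rw [Matrix.hadamard_apply] at hk
      rw [hk]
      simp [I.card_ne_zero]
    · rintro h - ⟨hhj, hhi⟩
      have : I.q h i j = 0 := by
        rw [I.q_rotate_eq_zero_iff]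
        by_contra hq
        rcases hstar h j ⟨hhj, hq⟩ with e | e
        · exact hhi e
        · exact hji e
      simp [this]
    · simp
    · simp
  have hβ : (I.q i i j : ℂ) ≠ 0 := by
    obtain ⟨s, hs⟩ : ∃ s, (I.diagram i).Adj j s := by
      have : Nontrivial (Fin (Γ.D + 1)) := ⟨j, i, hji⟩
      exact (I.diagram_connected hprim hi).preconnected.exists_adj_of_nontrivial j
    have hs' := (hstar j s hs).resolve_left hji
    subst hs'
    have := hs.2
    rw [I.q_comm] at this
    exact_mod_cast this
  have hy' := hprod y
  have hz' := hprod z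
  rw [hcos] at hy'
  have hα : (Fintype.card X : ℂ) * I.E i x z = I.q j i j := by
    have : ((Fintype.card X : ℂ) * I.E i x z - I.q j i j) * (I.E j x y - I.E j x z) = 0 := by
      linear_combination hy' - hz'
    exact sub_eq_zero.1 ((mul_eq_zero.1 this).resolve_right (sub_ne_zero.2 hj))
  have hiz : I.E i x z = 0 := by
    have : (I.q i i j : ℂ) * I.E i x z = 0 := by
      linear_combination hα * I.E j x z - hz'
    exact (mul_eq_zero.1 this).resolve_left hβ
  rw [hiz, mul_zero] at hα
  have hfac : ∀ w, I.E i x w ≠ 0 → (Fintype.card X : ℂ) * I.E j x w = I.q i i j := by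
    intro w hw
    refine mul_right_cancel₀ hw ?_
    have := hprod w
    rw [← hα] at this
    linear_combination this
  have hoff : ∀ w, w ≠ x → I.E i x w = 0 := by
    intro w hw
    by_contra hne
    exact I.E_apply_ne hprim hj0 hw.symm (mul_left_cancel₀ I.card_ne_zero
      ((hfac w hne).trans (hfac x (I.E_diag_ne_zero i x)).symm))
  have hrow := I.sum_E_row hi x
  rw [Finset.sum_eq_single x (fun w _ hw => hoff w hw) (by simp)] at hrow
  exact I.E_diag_ne_zero i x hrow

theorem diagram_degree_le_two (hprim : Γ.Primitive) {i : Fin (Γ.D + 1)} (hi : i ≠ 0)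
    {t : Fin 4 → ℂ} (ht : t ≠ 0)
    (hrel : ∀ h k, I.q i h k ≠ 0 → ∑ a, t a * I.bracketScalar a h k = 0)
    (a u w s : Fin (Γ.D + 1)) (hu : (I.diagram i).Adj a u) (hw : (I.diagram i).Adj a w)
    (hs : (I.diagram i).Adj a s) : u = w ∨ u = s ∨ w = s := by
  by_contra! hne
  obtain ⟨p, q, r, e, hpqr, hp, hq, hquad⟩ := I.exists_quadratic ht
  have hθ : ∀ {h k}, h ≠ k → (I.θ h : ℂ) ≠ I.θ k := fun hhk => by
    exact_mod_cast I.hθinj.ne hhk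
  have heval : ∀ {k}, (I.diagram i).Adj a k → p * (I.θ k : ℂ) ^ 2 + (q * I.θ a + r) * I.θ k +
      (p * (I.θ a : ℂ) ^ 2 + r * I.θ a + e) = 0 := fun hk => by
    linear_combination hquad _ _ hk.1 (hrel _ _ hk.2)
  obtain ⟨e1, e2, e3⟩ := quadratic_coeffs_eq_zero (hθ hne.1) (hθ hne.2.1) (hθ hne.2.2)
    (heval hu) (heval hw) (heval hs)
  subst e1
  have er : r = -q * I.θ a := by linear_combination e2
  have ee : e = q * (I.θ a : ℂ) ^ 2 := by linear_combination e3 - I.θ a * er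
  have hq0 : q ≠ 0 := by
    rintro rfl
    exact hpqr ⟨rfl, rfl, by simpa using er, by simpa using ee⟩
  have hstar : ∀ h k, (I.diagram i).Adj h k → h = a ∨ k = a := by
    intro h k hhk
    have := hquad _ _ hhk.1 (hrel _ _ hhk.2)
    have hmul : q * (((I.θ h : ℂ) - I.θ a) * ((I.θ k : ℂ) - I.θ a)) = 0 := by
      rw [er, ee] at this
      linear_combination this
    by_contra! hcon
    exact mul_ne_zero hq0 (mul_ne_zero (sub_ne_zero.2 (hθ hcon.1)) (sub_ne_zero.2 (hθ hcon.2))) hmul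
  have ha : a = i := by
    have h0i := (I.diagram_zero_adj hi (k := i)).2 rfl
    rcases hstar 0 i h0i with h | h
    · subst h
      exact absurd (((I.diagram_zero_adj hi).1 hu).trans ((I.diagram_zero_adj hi).1 hw).symm) hne.1
    · exact h.symm
  subst ha
  exact I.not_star hprim hi (hq rfl hq0) (hp rfl) hrel hstar

theorem krein_degree {σ : Equiv.Perm (Fin (Γ.D + 1))} (hσ0 : σ 0 = 0) {i : Fin (Γ.D + 1)}
    (hadj : ∀ a b, (I.diagram i).Adj (σ a) (σ b) ↔ (a : ℕ) + 1 = b ∨ (b : ℕ) + 1 = a)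
    (n : ℕ) (hn : n < Γ.D + 1) (j h : Fin (Γ.D + 1)) :
    (n + (j : ℕ) < h → I.q (σ h) (σ ⟨n, hn⟩) (σ j) = 0) ∧
      ((h : ℕ) = n + j → I.q (σ h) (σ ⟨n, hn⟩) (σ j) ≠ 0) := by
  have hq1 : ∀ h j : Fin (Γ.D + 1), (j : ℕ) + 1 < h → I.q (σ h) i (σ j) = 0 := by
    intro h j hjh
    rw [I.q_rotate_eq_zero_iff]
    by_contra hq
    have := (hadj h j).1 ⟨fun e => by have := σ.injective e; subst this; omega, hq⟩
    omega
  have hq1' : ∀ h j : Fin (Γ.D + 1), (h : ℕ) = j + 1 → I.q (σ h) i (σ j) ≠ 0 := by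
    intro h j hjh
    rw [Ne, I.q_rotate_eq_zero_iff]
    exact ((hadj h j).2 (Or.inr hjh.symm)).2
  induction n using Nat.strong_induction_on generalizing j h with
  | _ n ih =>
    cases n with
    | zero =>
      have : σ ⟨0, hn⟩ = 0 := hσ0
      rw [this, I.q_zero]
      constructor
      · intro hlt
        rw [if_neg]
        intro e
        have := σ.injective e
        subst this
        omega
      · intro heq
        rw [if_pos (congrArg σ (Fin.ext (by omega)))]
        exact one_ne_zero
    | succ n =>
      have hassoc := I.q_assoc (σ h) i (σ ⟨n, by omega⟩) (σ j)
      rw [← Equiv.sum_comp σ, ← Equiv.sum_comp σ (fun l => I.q l _ _ * _)] at hassoc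
      by_cases hle : n + 1 + (j : ℕ) ≤ h
      · rw [Finset.sum_eq_single ⟨n + 1, hn⟩] at hassoc
        · constructor
          · intro hlt
            rw [Finset.sum_eq_zero, mul_eq_zero] at hassoc
            · exact hassoc.resolve_left (hq1' _ _ rfl)
            · intro l _
              by_cases hl : n + (j : ℕ) < l
              · rw [(ih n (by omega) _ j l).1 hl, zero_mul]
              · rw [hq1 h l (by omega), mul_zero]
          · intro heq h0
            rw [h0, mul_zero, Finset.sum_eq_single ⟨n + j, by omega⟩] at hassoc
            · rcases mul_eq_zero.1 hassoc.symm with e | e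
              · exact (ih n (by omega) _ j _).2 rfl e
              · exact hq1' h ⟨n + j, by omega⟩ (by simp only; omega) e
            · intro l _ hl
              by_cases hl' : n + (j : ℕ) < l
              · rw [(ih n (by omega) _ j l).1 hl', zero_mul]
              · have : (l : ℕ) ≠ n + j := fun e => hl (Fin.ext e)
                rw [hq1 h l (by omega), mul_zero]
            · simp
        · intro l _ hl
          by_cases hl' : n + 1 < (l : ℕ)
          · rw [hq1 l ⟨n, by omega⟩ hl', zero_mul]
          · have : (l : ℕ) ≠ n + 1 := fun e => hl (Fin.ext e)
            rw [(ih l (by omega) l.2 j h).1 (by omega), mul_zero]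
        · simp
      · exact ⟨fun hlt => absurd hlt.le hle, fun heq => absurd heq.ge hle⟩

theorem qPolyOrdering_of_diagram {σ : Equiv.Perm (Fin (Γ.D + 1))} (hσ0 : σ 0 = 0)
    {i : Fin (Γ.D + 1)}
    (hadj : ∀ a b, (I.diagram i).Adj (σ a) (σ b) ↔ (a : ℕ) + 1 = b ∨ (b : ℕ) + 1 = a) :
    QPolyOrdering I σ := by
  intro h a b
  have h1 := I.krein_degree hσ0 hadj a a.2 b h
  have h2 := I.krein_degree hσ0 hadj h h.2 b a
  have h3 := I.krein_degree hσ0 hadj h h.2 a b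
  have e2 : I.q (σ h) (σ a) (σ b) = 0 ↔ I.q (σ a) (σ h) (σ b) = 0 := I.q_rotate_eq_zero_iff _ _ _
  have e3 : I.q (σ h) (σ a) (σ b) = 0 ↔ I.q (σ b) (σ h) (σ a) = 0 := by
    rw [I.q_comm, I.q_rotate_eq_zero_iff]
  constructor
  · rintro (e | e | e)
    · exact h1.1 e
    · exact e2.2 (h2.1 e)
    · exact e3.2 (h3.1 e)
  · rintro (e | e | e)
    · exact h1.2 e
    · exact fun h0 => h2.2 e (e2.1 h0)
    · exact fun h0 => h3.2 e (e3.1 h0)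

theorem bracket_relation_of_qPolyOrdering (hprim : Γ.Primitive)
    {σ : Equiv.Perm (Fin (Γ.D + 1))} (hσ0 : σ 0 = 0) (hQ : QPolyOrdering I σ) :
    ∃ i : Fin (Γ.D + 1), i ≠ 0 ∧ ∃ t : Fin 4 → ℂ, t ≠ 0 ∧
      ∀ h k, I.q i h k ≠ 0 → ∑ a, t a * I.bracketScalar a h k = 0 := by
  have hD := Γ.hD
  obtain ⟨x, -, -⟩ := Γ.hdiam
  set i := σ ⟨1, by omega⟩ with hidef
  have hi : i ≠ 0 := by
    rw [← hσ0, hidef]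
    exact σ.injective.ne (fun h => by simpa using congrArg Fin.val h)
  have hanti : ∀ h k, I.bracketScalar 0 h k = -I.bracketScalar 0 k h := fun h k => by
    simp only [bracketScalar, Matrix.cons_val]; ring
  -- The diagram of `E_i` is a path, so the first bracket has a potential on its vertices.
  obtain ⟨r, hr⟩ : ∃ r : Fin (Γ.D + 1) → ℂ, ∀ h k, I.q i h k ≠ 0 →
      I.bracketScalar 0 h k = r h - r k := by
    let d : ℕ → ℂ := fun m => if hm : m + 1 < Γ.D + 1 then
      I.bracketScalar 0 (σ ⟨m, by omega⟩) (σ ⟨m + 1, hm⟩) else 0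
    let ρ : ℕ → ℂ := fun n => -∑ m ∈ Finset.range n, d m
    have hstep : ∀ a b : Fin (Γ.D + 1), (a : ℕ) + 1 = b →
        I.bracketScalar 0 (σ a) (σ b) = ρ a - ρ b := by
      rintro a ⟨b, hb⟩ hab
      simp only at hab
      subst hab
      simp only [ρ, Finset.sum_range_succ, d]
      rw [dif_pos hb]
      ring
    refine ⟨fun h => ρ (σ.symm h), fun h k hq => ?_⟩
    obtain ⟨a, rfl⟩ := σ.surjective h
    obtain ⟨b, rfl⟩ := σ.surjective k
    simp only [Equiv.symm_apply_apply]
    have hab := mt (hQ ⟨1, by omega⟩ a b).1 hq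
    simp only [not_or, not_lt] at hab
    rcases (by omega : (a : ℕ) = b ∨ (a : ℕ) + 1 = b ∨ (b : ℕ) + 1 = a) with e | e | e
    · obtain rfl := Fin.ext e
      simp [bracketScalar, mul_comm]
    · exact hstep a b e
    · rw [hanti, hstep b a e]
      ring
  obtain ⟨ρ, hρ⟩ := (Submodule.mem_span_range_iff_exists_fun ℂ).1
    (Submodule.sum_mem _ fun h (_ : h ∈ Finset.univ) => Submodule.smul_mem _ (r h) (I.hEbasis h))
  set R : Matrix X X ℂ := ∑ h, r h • I.E h with hR
  have hER : ∀ h, I.E h * R = r h • I.E h := fun h => by simp [hR, Finset.mul_sum, I.hEmul]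
  have hRE : ∀ h, R * I.E h = r h • I.E h := fun h => by simp [hR, Finset.sum_mul, I.hEmul]
  have hbr : Γ.bracket 0 (I.Astar x i) = R * I.Astar x i - I.Astar x i * R := by
    rw [← sub_eq_zero]
    refine I.eq_zero_of_blocks fun h k => ?_
    have : I.E h * (R * I.Astar x i - I.Astar x i * R) * I.E k =
        (r h - r k) • (I.E h * I.Astar x i * I.E k) := by
      rw [mul_sub, sub_mul, ← mul_assoc, hER, mul_assoc (I.E h), mul_assoc _ R, hRE, sub_smul]
      simp [mul_assoc]
    rw [mul_sub, sub_mul, this, E_mul_bracket_mul_E, ← sub_smul]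
    by_cases hq : I.q i h k = 0
    · rw [I.E_mul_Astar_mul_E_eq_zero x hq, smul_zero]
    · rw [hr h k hq, sub_self, zero_smul]
  have hρ0 : ∀ n : Fin (Γ.D + 1), 3 < (n : ℕ) → ρ n = 0 := by
    intro n hn
    obtain ⟨z, hz⟩ := Γ.exists_dist_eq x (Nat.lt_succ_iff.1 n.2)
    have hRz : R x z = ρ n := by
      rw [← hρ]
      simp [Matrix.sum_apply, DRG.A_apply, hz, Fin.val_inj]
    have hvan : ∀ m l, m + l = 3 → (Γ.A m * (I.Astar x i * Γ.A l)) x z = 0 := by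
      intro m l hml
      rw [Matrix.mul_apply]
      refine Finset.sum_eq_zero fun w _ => ?_
      rw [Astar, Matrix.diagonal_mul, Γ.A_apply m, Γ.A_apply l]
      have := Γ.hconn.dist_triangle (u := x) (v := w) (w := z)
      by_cases hw : Γ.G.dist x w = m
      · rw [if_neg (by omega : ¬ Γ.G.dist w z = l)]
        simp
      · simp [hw]
    have h1 := congrFun (congrFun hbr x) z
    simp only [DRG.bracket, Matrix.cons_val, LinearMap.sub_apply, LinearMap.comp_apply,
      LinearMap.mulLeft_apply, LinearMap.mulRight_apply, Matrix.sub_apply,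
      hvan 2 1 rfl, hvan 1 2 rfl] at h1
    simp only [Astar, Matrix.mul_diagonal, Matrix.diagonal_mul, hRz] at h1
    have hxz : x ≠ z := by
      rintro rfl
      rw [SimpleGraph.dist_self] at hz
      omega
    have h2 : (Fintype.card X : ℂ) * (I.E i x z - I.E i x x) * ρ n = 0 := by
      linear_combination -h1
    simpa [I.card_ne_zero, sub_eq_zero, I.E_apply_ne hprim hi hxz] using h2
  have hrh : ∀ h, r h = ∑ n : Fin (Γ.D + 1), ρ n * I.eigval n h := by
    intro h
    refine smul_left_injective ℂ (I.E_ne_zero h) ?_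
    simp only
    rw [← hRE, ← hρ, Finset.sum_mul, Finset.sum_smul]
    refine Finset.sum_congr rfl fun n _ => ?_
    rw [smul_mul_assoc, A_mul_E (Nat.lt_succ_iff.1 n.2), smul_smul]
  let ρ' : ℕ → ℂ := fun n => if hn : n < Γ.D + 1 then ρ ⟨n, hn⟩ else 0
  have hrh' : ∀ h, r h = ∑ n ∈ Finset.range 4, ρ' n * I.eigval n h := by
    intro h
    rw [hrh, Finset.sum_subset (Finset.range_subset_range.2 (by omega : 4 ≤ Γ.D + 1)),
      Finset.sum_range]
    · exact Finset.sum_congr rfl fun n _ => by rw [show ρ' n = ρ n from dif_pos n.2]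
    · intro n hn hn'
      simp only [Finset.mem_range] at hn hn'
      simp [ρ', hρ0 ⟨n, hn⟩ (by simp only; omega)]
  refine ⟨i, hi, ![1, -ρ' 3, -ρ' 2, -ρ' 1], fun h => by simpa using congrFun h 0, ?_⟩
  intro h k hq
  have := hr h k hq
  rw [hrh', hrh'] at this
  simp only [Finset.sum_range_succ, Finset.sum_range_zero, I.eigval_zero] at this
  simp only [Fin.sum_univ_four, Matrix.cons_val, this]
  simp only [bracketScalar, Matrix.cons_val]
  ring

theorem exists_qPolyOrdering_iff (hprim : Γ.Primitive) :
    (∃ σ : Equiv.Perm (Fin (Γ.D + 1)), σ 0 = 0 ∧ QPolyOrdering I σ) ↔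
      ∃ i : Fin (Γ.D + 1), i ≠ 0 ∧ ∃ t : Fin 4 → ℂ, t ≠ 0 ∧
        ∀ h k, I.q i h k ≠ 0 → ∑ a, t a * I.bracketScalar a h k = 0 := by
  constructor
  · rintro ⟨σ, hσ0, hQ⟩
    exact I.bracket_relation_of_qPolyOrdering hprim hσ0 hQ
  · rintro ⟨i, hi, t, ht, hrel⟩
    obtain ⟨σ, hσ0, hadj⟩ := (I.diagram_connected hprim hi).exists_path_ordering
      (fun u w hu hw => ((I.diagram_zero_adj hi).1 hu).trans ((I.diagram_zero_adj hi).1 hw).symm)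
      (I.diagram_degree_le_two hprim hi ht hrel)
    exact ⟨σ, hσ0, I.qPolyOrdering_of_diagram hσ0 hadj⟩

end IdemSys

/-- A primitive distance-regular graph `Γ` with diameter `D ≥ 3` is
`Q`-polynomial if and only if `det G = 0`, where `G` is the `4D × 4D` Gram matrix of the
matrices `A_2E_i*A − AE_i*A_2, A_3E_i* − E_i*A_3, A_2E_i* − E_i*A_2, AE_i* − E_i*A`
(`1 ≤ i ≤ D`). -/
theorem stmt_0 {X : Type} [Fintype X] [DecidableEq X] (Γ : DRG X) (hprim : Γ.Primitive)
    (I : IdemSys Γ) (x : X) :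
    (∃ σ : Equiv.Perm (Fin (Γ.D + 1)), σ 0 = 0 ∧ QPolyOrdering I σ) ↔
      (Matrix.of fun pr qr : Fin Γ.D × Fin 4 =>
        DRG.inn (vecE Γ x pr.2 pr.1) (vecE Γ x qr.2 qr.1)).det = 0 := by
  rw [DRG.det_gram_eq_zero_iff fun p : Fin Γ.D × Fin 4 => vecE Γ x p.2 p.1,
    I.dependency_iff hprim x]
  exact I.exists_qPolyOrdering_iff hprim
end
end

section
/- Let Γ be a distance-regular graph with diameter D ≥ 3 and fix a base vertex x. The 4D×4D Gram matrix G̃ equals the block diagonal matrix with diagonal blocks B_1, B_2, ..., B_D; in particular, for distinct 1 ≤ i ≠ j ≤ D any matrix among A_2A_i*A − AA_i*A_2, A_3A_i* − A_i*A_3, A_2A_i* − A_i*A_2, AA_i* − A_i*A is orthogonal to any matrix among A_2A_j*A − AA_j*A_2, A_3A_j* − A_j*A_3, A_2A_j* − A_j*A_2, AA_j* − A_j*A, and det(G̃) = Π_{i=1}^D det(B_i). -/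
open Matrix BigOperators

noncomputable section

namespace DRG

variable {X : Type} [Fintype X] [DecidableEq X]

/-- The entries of `M` depend only on the distance between row and column index,
i.e. `M` lies in the Bose-Mesner algebra of `Γ`. -/
def IsDistMatrix (Γ : DRG X) (M : Matrix X X ℂ) : Prop :=
  ∃ f : ℕ → ℂ, ∀ y z, M y z = f (Γ.G.dist y z)

variable {Γ : DRG X}

theorem isDistMatrix_A (i : ℕ) : Γ.IsDistMatrix (Γ.A i) :=
  ⟨fun n => if n = i then 1 else 0, fun _ _ => rfl⟩

theorem isDistMatrix_one : Γ.IsDistMatrix 1 :=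
  ⟨fun n => if n = 0 then 1 else 0, fun y z => by
    simp [Matrix.one_apply, Γ.hconn.dist_eq_zero_iff]⟩

namespace IsDistMatrix

variable {M N : Matrix X X ℂ}

theorem transpose_eq (hM : Γ.IsDistMatrix M) : Mᵀ = M := by
  obtain ⟨f, hf⟩ := hM
  ext y z
  rw [Matrix.transpose_apply, hf, hf, SimpleGraph.dist_comm]

theorem hadamard (hM : Γ.IsDistMatrix M) (hN : Γ.IsDistMatrix N) :
    Γ.IsDistMatrix (Matrix.hadamard M N) := by
  obtain ⟨f, hf⟩ := hM
  obtain ⟨g, hg⟩ := hN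
  exact ⟨fun n => f n * g n, fun y z => by rw [Matrix.hadamard_apply, hf, hg]⟩

theorem mul (hM : Γ.IsDistMatrix M) (hN : Γ.IsDistMatrix N) : Γ.IsDistMatrix (M * N) := by
  obtain ⟨f, hf⟩ := hM
  obtain ⟨g, hg⟩ := hN
  refine ⟨fun h => ∑ q ∈ Finset.range (Γ.D + 1) ×ˢ Finset.range (Γ.D + 1),
    (Γ.p h q.1 q.2 : ℂ) * (f q.1 * g q.2), fun y z => ?_⟩
  rw [Matrix.mul_apply, ← Finset.sum_fiberwise_of_maps_to
    (g := fun w => (Γ.G.dist y w, Γ.G.dist z w))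
    (t := Finset.range (Γ.D + 1) ×ˢ Finset.range (Γ.D + 1))]
  · refine Finset.sum_congr rfl fun q hq => ?_
    simp only [Finset.mem_product, Finset.mem_range, Nat.lt_succ_iff] at hq
    rw [← Γ.hp _ q.1 q.2 (Γ.hdiam_le y z) hq.1 hq.2 y z rfl, Nat.card_eq_fintype_card,
      Fintype.card_subtype, ← nsmul_eq_mul, ← Finset.sum_const]
    refine Finset.sum_congr (by ext w; simp [Prod.ext_iff]) fun w hw => ?_
    simp only [Finset.mem_filter, Finset.mem_univ, true_and] at hw
    rw [hf, hg, SimpleGraph.dist_comm (u := w), hw.1, hw.2]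
  · intro w _
    simp [Γ.hdiam_le]

theorem commute (hM : Γ.IsDistMatrix M) (hN : Γ.IsDistMatrix N) : M * N = N * M := by
  rw [← (hM.mul hN).transpose_eq, Matrix.transpose_mul, hM.transpose_eq, hN.transpose_eq]

theorem of_mem_span {ι : Type*} (d : ι → ℕ)
    (hM : M ∈ Submodule.span ℂ (Set.range fun n => Γ.A (d n))) : Γ.IsDistMatrix M := by
  induction hM using Submodule.span_induction with
  | mem M h =>
    obtain ⟨n, rfl⟩ := h
    exact isDistMatrix_A _
  | zero => exact ⟨0, fun _ _ => rfl⟩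
  | add M N _ _ hM hN =>
    obtain ⟨f, hf⟩ := hM
    obtain ⟨g, hg⟩ := hN
    exact ⟨f + g, fun y z => by simp [hf, hg]⟩
  | smul c M _ hM =>
    obtain ⟨f, hf⟩ := hM
    exact ⟨c • f, fun y z => by simp [hf]⟩

end IsDistMatrix

theorem map_conj_A (i : ℕ) : (Γ.A i).map (starRingEnd ℂ) = Γ.A i := by
  ext y z
  simp only [A, Matrix.map_apply, Matrix.of_apply]
  split_ifs <;> simp

end DRG

namespace IdemSys

variable {X : Type} [Fintype X] [DecidableEq X] {Γ : DRG X} (I : IdemSys Γ) (x : X)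

theorem isDistMatrix_E (i : Fin (Γ.D + 1)) : Γ.IsDistMatrix (I.E i) :=
  .of_mem_span _ (I.hEbasis i)

theorem map_conj_Astar (i : Fin (Γ.D + 1)) :
    (I.Astar x i).map (starRingEnd ℂ) = I.Astar x i := by
  have h (y : X) : starRingEnd ℂ (I.E i x y) = I.E i x y := congrFun₂ (I.hEreal i) x y
  rw [Astar, Matrix.diagonal_map (map_zero _)]
  simp [h]

theorem trace_mul_Astar_mul_Astar {M N : Matrix X X ℂ} (hM : Γ.IsDistMatrix M)
    (hN : Γ.IsDistMatrix N) {i j : Fin (Γ.D + 1)} (hij : i ≠ j) :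
    (M * I.Astar x i * (N * I.Astar x j)).trace = 0 := by
  have hW := hM.hadamard hN
  have h0 : I.E j * Matrix.hadamard M N * I.E i = 0 := by
    rw [(I.isDistMatrix_E j).commute hW, Matrix.mul_assoc, I.hEmul, if_neg hij.symm,
      Matrix.mul_zero]
  have hs (y z : X) : N y z = N z y := congrFun₂ hN.transpose_eq z y
  have hE (y : X) : I.E i x y = I.E i y x := congrFun₂ (I.hEsymm i) y x
  calc (M * I.Astar x i * (N * I.Astar x j)).trace
      = (Fintype.card X : ℂ) ^ 2 * (I.E j * Matrix.hadamard M N * I.E i) x x := by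
        simp only [Matrix.trace, Matrix.diag_apply, Matrix.mul_apply (M := M * _), Astar,
          Matrix.mul_diagonal, Matrix.mul_apply (M := I.E j * _),
          Matrix.mul_apply (M := I.E j), Matrix.hadamard_apply, Finset.mul_sum, Finset.sum_mul]
        rw [Finset.sum_comm]
        refine Finset.sum_congr rfl fun y _ => Finset.sum_congr rfl fun z _ => ?_
        rw [hs y z, hE y]
        ring
    _ = 0 := by rw [h0]; simp

theorem trace_transpose_mul_sandwich {P Q R S : Matrix X X ℂ} (hP : Γ.IsDistMatrix P)
    (hQ : Γ.IsDistMatrix Q) (hR : Γ.IsDistMatrix R) (hS : Γ.IsDistMatrix S)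
    {i j : Fin (Γ.D + 1)} (hij : i ≠ j) :
    ((P * I.Astar x i * Q)ᵀ * (R * I.Astar x j * S)).trace = 0 := by
  have hA : (I.Astar x i)ᵀ = I.Astar x i := Matrix.diagonal_transpose _
  rw [← I.trace_mul_Astar_mul_Astar x (hS.mul hQ) (hP.mul hR) hij, Matrix.transpose_mul,
    Matrix.transpose_mul, hA, hP.transpose_eq, hQ.transpose_eq, ← Matrix.mul_assoc,
    Matrix.trace_mul_comm]
  simp only [Matrix.mul_assoc]

/-- Each of the matrices `vecA` is a commutator-type expression in two distance matrices. -/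
theorem exists_vecA_eq (a : Fin 4) : ∃ P Q : Matrix X X ℂ,
    Γ.IsDistMatrix P ∧ Γ.IsDistMatrix Q ∧
    ∀ i, vecA I x a i = P * I.Astar x i.succ * Q - Q * I.Astar x i.succ * P := by
  fin_cases a
  · exact ⟨_, _, Γ.isDistMatrix_A 2, Γ.isDistMatrix_A 1, fun _ => rfl⟩
  · exact ⟨_, _, Γ.isDistMatrix_A 3, Γ.isDistMatrix_one, fun _ => by simp [vecA]⟩
  · exact ⟨_, _, Γ.isDistMatrix_A 2, Γ.isDistMatrix_one, fun _ => by simp [vecA]⟩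
  · exact ⟨_, _, Γ.isDistMatrix_A 1, Γ.isDistMatrix_one, fun _ => by simp [vecA]⟩

theorem map_conj_vecA (a : Fin 4) (i : Fin Γ.D) :
    (vecA I x a i).map (starRingEnd ℂ) = vecA I x a i := by
  fin_cases a <;>
    simp [vecA, Matrix.map_sub, Matrix.map_mul, DRG.map_conj_A, map_conj_Astar]

theorem inn_vecA_eq_zero {i j : Fin Γ.D} (hij : i ≠ j) (a b : Fin 4) :
    DRG.inn (vecA I x a i) (vecA I x b j) = 0 := by
  obtain ⟨P, Q, hP, hQ, h⟩ := I.exists_vecA_eq x a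
  obtain ⟨R, S, hR, hS, h'⟩ := I.exists_vecA_eq x b
  have hij' : i.succ ≠ j.succ := (Fin.succ_injective _).ne hij
  rw [DRG.inn, map_conj_vecA, h, h', Matrix.transpose_sub, Matrix.sub_mul, Matrix.mul_sub,
    Matrix.mul_sub]
  simp only [Matrix.trace_sub, I.trace_transpose_mul_sandwich x hP hQ hR hS hij',
    I.trace_transpose_mul_sandwich x hP hQ hS hR hij',
    I.trace_transpose_mul_sandwich x hQ hP hR hS hij',
    I.trace_transpose_mul_sandwich x hQ hP hS hR hij', sub_zero]

end IdemSys

/-- the Gram matrix `G̃` is block diagonal with blocks `B_1, ..., B_D`;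
in particular the families for distinct `i ≠ j` are mutually orthogonal and
`det(G̃) = Π_{i=1}^D det(B_i)`. -/
theorem stmt_12 {X : Type} [Fintype X] [DecidableEq X] (Γ : DRG X) (I : IdemSys Γ) (x : X) :
    (∀ i j : Fin Γ.D, i ≠ j → ∀ a b : Fin 4,
      DRG.inn (vecA I x a i) (vecA I x b j) = 0) ∧
    (Matrix.of fun pr qr : Fin 4 × Fin Γ.D =>
        DRG.inn (vecA I x pr.1 pr.2) (vecA I x qr.1 qr.2)) =
      Matrix.blockDiagonal (fun i : Fin Γ.D =>
        Matrix.of fun a b : Fin 4 => DRG.inn (vecA I x a i) (vecA I x b i)) ∧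
    (Matrix.of fun pr qr : Fin 4 × Fin Γ.D =>
        DRG.inn (vecA I x pr.1 pr.2) (vecA I x qr.1 qr.2)).det =
      ∏ i : Fin Γ.D,
        (Matrix.of fun a b : Fin 4 => DRG.inn (vecA I x a i) (vecA I x b i)).det := by
  have hblock : (Matrix.of fun pr qr : Fin 4 × Fin Γ.D =>
        DRG.inn (vecA I x pr.1 pr.2) (vecA I x qr.1 qr.2)) =
      Matrix.blockDiagonal (fun i : Fin Γ.D =>
        Matrix.of fun a b : Fin 4 => DRG.inn (vecA I x a i) (vecA I x b i)) := by
    ext ⟨a, i⟩ ⟨b, j⟩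
    rw [Matrix.blockDiagonal_apply]
    split_ifs with hij
    · obtain rfl : i = j := hij
      rfl
    · exact I.inn_vecA_eq_zero x hij a b
  exact ⟨fun i j hij => I.inn_vecA_eq_zero x hij, hblock,
    by rw [hblock, Matrix.det_blockDiagonal]⟩
end
end
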